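/- Let $n\ge 1$. For a measurable function $p:\mathbb{R}^n\to(0,\infty)$ with $0<p_-=\inf p\le p_+=\sup p<\infty$ and a measurable $f:\mathbb{R}^n\to[-\infty,\infty]$, put $$\|f\|_{p(\cdot)}=\inf\Big\{\lambda>0:\int_{\mathbb{R}^n}\Big|\frac{f(x)}{\lambda}\Big|^{p(x)}dx\le 1\Big\},$$ with $\inf\emptyset=\infty$, and let $\underline{p}=\min(p_-,1)$. For $z\in\mathbb{R}^n$ and $r>0$ let $Q(z,r)$ be the cube centered at $z$ with side length $r$ (sides parallel to the axes), and let $\chi_Q$ be the characteristic function of a cube $Q$. For a sequence $\{\lambda_j\}_{j=1}^\infty$ of nonnegative numbers and a sequence $\{Q_j\}_{j=1}^\infty$ of cubes define $$\mathcal{A}\big(\{\lambda_j\}_{j=1}^\infty,\{Q_j\}_{j=1}^\infty,p(\cdot)\big)=\Bigg\|\Bigg(\sum_{j=1}^\infty\Big(\frac{\lambda_j\chi_{Q_j}}{\|\chi_{Q_j}\|_{p(\cdot)}}\Big)^{\underline{p}}\Bigg)^{1/\underline{p}}\Bigg\|_{p(\cdot)}\in[0,\infty],$$ where the series of nonnegative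 terms takes values in $[0,\infty]$. Let $A$ be an invertible real $n\times n$ matrix and let $D=\|A\|$ be its operator norm with respect to the Euclidean norm. Let $p:\mathbb{R}^n\to(0,\infty)$ satisfy $0<p_-\le p_+<\infty$, the local log-Hölder condition (there is $c>0$ with $|p(x)-p(y)|\le c/(-\log|x-y|)$ whenever $0<|x-y|<1/2$), the log-Hölder condition at infinity (there are $C_\infty>0$ and $p_\infty\in\mathbb{R}$ with $|p(x)-p_\infty|\le C_\infty/\log(e+|x|)$ for all $x\in\mathbb{R}^n$), and $p(Ax)=p(x)$ for all $x\in\mathbb{R}^n$. Then there is a constant $C>0$, independent of the sequences below, such that for every sequence $\{\lambda_j\}_{j=1}^\infty$ of nonnegative numbers and every sequence of cubes $Q_j=Q(z_j,r_j)$, with $Q_j^*=Q(Az_j,4Dr_j)$, $$\mathcal{A}\big(\{\lambda_j\}_{j=1}^\infty,\{Q_j^*\}_{j=1}^\infty,p(\cdot)\big)\le C\,\mathcal{A}\big(\{\lambda_j\}_{j=1}^\infty,\{Q_j\}_{j=1}^\infty,p(\cdot)\big).$$ -/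

import Mathlib

open MeasureTheory
open scoped ENNReal NNReal

noncomputable section

/-- `ℝⁿ` with the Euclidean norm and Lebesgue measure. -/
abbrev Rn (n : ℕ) := EuclideanSpace ℝ (Fin n)

/-- The variable exponent Lebesgue quasinorm
`‖f‖_{p(·)} = inf {l > 0 : ∫ (f(x)/l)^{p(x)} dx ≤ 1}` of a function `f` with values in `[0,∞]`;
it is `∞` if no such `l` exists. -/
def varLpNorm {n : ℕ} (p : Rn n → ℝ) (f : Rn n → ℝ≥0∞) : ℝ≥0∞ :=
  ⨅ (l : ℝ≥0) (_ : 0 < l) (_ : ∫⁻ x, (f x / l) ^ p x ≤ 1), (l : ℝ≥0∞)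

/-- The local log-Hölder condition. -/
def LogHolderLocal {n : ℕ} (p : Rn n → ℝ) : Prop :=
  ∃ c : ℝ, 0 < c ∧ ∀ x y : Rn n, ‖x - y‖ < 1 / 2 → |p x - p y| ≤ c / (-Real.log ‖x - y‖)

/-- The log-Hölder condition at infinity. -/
def LogHolderInfty {n : ℕ} (p : Rn n → ℝ) : Prop :=
  ∃ C : ℝ, 0 < C ∧ ∃ pinf : ℝ, ∀ x : Rn n, |p x - pinf| ≤ C / Real.log (Real.exp 1 + ‖x‖)

/-- The (closed) cube `Q(z,r)` centered at `z` with side length `r`. -/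
def cube {n : ℕ} (z : Rn n) (r : ℝ) : Set (Rn n) := {x | ∀ i, |x i - z i| ≤ r / 2}

/-- The characteristic function of the cube `Q(z,r)`. -/
def cubeInd {n : ℕ} (z : Rn n) (r : ℝ) : Rn n → ℝ≥0∞ := (cube z r).indicator 1

/-- `p₋ = inf p`. -/
def pLow {n : ℕ} (p : Rn n → ℝ) : ℝ := ⨅ x, p x

/-- `p̲ = min (p₋, 1)`. -/
def pUnder {n : ℕ} (p : Rn n → ℝ) : ℝ := min (pLow p) 1

/-- The quantity `𝒜({λ_j},{Q_j},p(·))` for the cubes `Q_j = Q(z_j, r_j)`. The series of nonnegative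
terms is summed in `[0,∞]`, so that it is `∞` where it diverges. -/
def AFun {n : ℕ} (p : Rn n → ℝ) (lam : ℕ → ℝ≥0) (z : ℕ → Rn n) (r : ℕ → ℝ) : ℝ≥0∞ :=
  varLpNorm p (fun x =>
    (∑' j, ((lam j : ℝ≥0∞) * cubeInd (z j) (r j) x / varLpNorm p (cubeInd (z j) (r j)))
      ^ pUnder p) ^ (1 / pUnder p))

end

/-! ### Step functions over nested families of sets -/

section Nested

variable {ι X : Type*}

/-- The step function `∑ j ∈ S, a j * 1_{P j}`. -/
noncomputable def stepFun (S : Finset ι) (a : ι → ℝ≥0) (P : ι → Set X) (x : X) : ℝ≥0 :=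
  ∑ j ∈ S, (P j).indicator (fun _ => a j) x

open Classical in
/-- The total weight of the sets of the family that contain `P j`. -/
noncomputable def aboveSum (S : Finset ι) (a : ι → ℝ≥0) (P : ι → Set X) (j : ι) : ℝ≥0 :=
  ∑ i ∈ S with P j ⊆ P i, a i

/-- Any two sets of the family are disjoint or comparable. -/
def NestedOn (S : Finset ι) (P : ι → Set X) : Prop :=
  ∀ i ∈ S, ∀ j ∈ S, P i ⊆ P j ∨ P j ⊆ P i ∨ Disjoint (P i) (P j)

open Classical in
theorem stepFun_eq_sum_filter (S : Finset ι) (a : ι → ℝ≥0) (P : ι → Set X) (x : X) :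
    stepFun S a P x = ∑ j ∈ S with x ∈ P j, a j := by
  simp [stepFun, Finset.sum_filter, Set.indicator_apply]

theorem aboveSum_le_stepFun (S : Finset ι) (a : ι → ℝ≥0) (P : ι → Set X) {j : ι} {x : X}
    (hx : x ∈ P j) : aboveSum S a P j ≤ stepFun S a P x := by
  classical
  rw [stepFun_eq_sum_filter, aboveSum]
  refine Finset.sum_le_sum_of_subset fun i hi => ?_
  rw [Finset.mem_filter] at hi ⊢
  exact ⟨hi.1, hi.2 hx⟩

theorem stepFun_mono (S : Finset ι) (a : ι → ℝ≥0) {P Q : ι → Set X} (h : ∀ j ∈ S, P j ⊆ Q j)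
    (x : X) : stepFun S a P x ≤ stepFun S a Q x :=
  Finset.sum_le_sum fun j hj => Set.indicator_le_indicator_of_subset (h j hj) (by simp) x

theorem stepFun_smul (S : Finset ι) (a : ι → ℝ≥0) (P : ι → Set X) (c : ℝ≥0) (x : X) :
    stepFun S (fun j => c * a j) P x = c * stepFun S a P x := by
  classical
  simp [stepFun_eq_sum_filter, Finset.mul_sum]

theorem measurable_stepFun [MeasurableSpace X] (S : Finset ι) (a : ι → ℝ≥0) {P : ι → Set X}
    (hP : ∀ j ∈ S, MeasurableSet (P j)) : Measurable (stepFun S a P) := by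
  unfold stepFun
  exact Finset.measurable_sum _ fun j hj => measurable_const.indicator (hP j hj)

open Classical in
theorem NestedOn.sum_filter_aboveSum_lt_le {S : Finset ι} {P : ι → Set X} (h : NestedOn S P)
    (a : ι → ℝ≥0) (x : X) (τ : ℝ≥0) :
    ∑ j ∈ S with x ∈ P j ∧ aboveSum S a P j < τ, a j ≤ τ := by
  set T := S.filter fun j => x ∈ P j ∧ aboveSum S a P j < τ with hT
  rcases T.eq_empty_or_nonempty with h0 | h0
  · simp [h0]
  obtain ⟨j, hj, hmin⟩ := Finset.exists_minimalFor P T h0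
  have hj' := hj
  rw [hT, Finset.mem_filter] at hj'
  refine le_trans (Finset.sum_le_sum_of_subset fun i hi => ?_) hj'.2.2.le
  have hi' := hi
  rw [hT, Finset.mem_filter] at hi'
  rw [Finset.mem_filter]
  refine ⟨hi'.1, ?_⟩
  rcases h i hi'.1 j hj'.1 with h1 | h1 | h1
  · exact hmin hi h1
  · exact h1
  · exact (Set.disjoint_left.1 h1 hi'.2.1 hj'.2.1).elim

theorem NNReal.rpow_eq_mul_rpow_sub_one (t : ℝ≥0) {q : ℝ} (hq : 1 ≤ q) :
    t ^ q = t * t ^ (q - 1) := by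
  rw [← NNReal.rpow_one_add' (by linarith)]
  congr 1; ring

open Classical in
/-- Only the sets whose ancestors carry at least half of the mass at `x` matter. -/
theorem NestedOn.rpow_stepFun_le {S : Finset ι} {P : ι → Set X} (h : NestedOn S P)
    (a : ι → ℝ≥0) (x : X) {τ : ℝ≥0} (hτ : 2 * τ < stepFun S a P x) {q : ℝ} (hq : 1 ≤ q) :
    stepFun S a P x ^ q ≤
      2 ^ q * ∑ j ∈ S with x ∈ P j ∧ τ < aboveSum S a P j, a j * aboveSum S a P j ^ (q - 1) := by
  set F := stepFun S a P x with hF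
  have hF0 : 0 < F := lt_of_le_of_lt (by positivity) hτ
  have h1 := h.sum_filter_aboveSum_lt_le a x (F / 2)
  have h2 : F = ∑ j ∈ S with x ∈ P j ∧ aboveSum S a P j < F / 2, a j +
      ∑ j ∈ S with x ∈ P j ∧ ¬ aboveSum S a P j < F / 2, a j := by
    conv_lhs => rw [hF, stepFun_eq_sum_filter]
    rw [← Finset.sum_filter_add_sum_filter_not _ (fun j => aboveSum S a P j < F / 2),
      Finset.filter_filter, Finset.filter_filter]
  have h3 : F / 2 ≤ ∑ j ∈ S with x ∈ P j ∧ ¬ aboveSum S a P j < F / 2, a j := by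
    have : F = F / 2 + F / 2 := (add_halves F).symm
    rw [← NNReal.coe_le_coe] at h1 ⊢
    rw [← NNReal.coe_inj] at h2 this
    push_cast at *
    linarith
  have h4 : F ^ q = 2 * (F / 2 * F ^ (q - 1)) := by
    rw [NNReal.rpow_eq_mul_rpow_sub_one F hq]; field_simp
  have h5 : (2 : ℝ≥0) ^ q = 2 * 2 ^ (q - 1) :=
    NNReal.rpow_eq_mul_rpow_sub_one 2 hq
  rw [h4, h5, mul_assoc]
  refine mul_le_mul_right ?_ _
  calc F / 2 * F ^ (q - 1)
      ≤ (∑ j ∈ S with x ∈ P j ∧ ¬ aboveSum S a P j < F / 2, a j) * F ^ (q - 1) := by gcongr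
    _ ≤ ∑ j ∈ S with x ∈ P j ∧ ¬ aboveSum S a P j < F / 2,
          2 ^ (q - 1) * (a j * aboveSum S a P j ^ (q - 1)) := by
        rw [Finset.sum_mul]
        refine Finset.sum_le_sum fun j hj => ?_
        rw [Finset.mem_filter, not_lt] at hj
        have : F ≤ 2 * aboveSum S a P j := by
          have := hj.2.2
          rw [div_le_iff₀ (by positivity)] at this
          rwa [mul_comm]
        calc a j * F ^ (q - 1) ≤ a j * (2 * aboveSum S a P j) ^ (q - 1) := by
              gcongr
          _ = _ := by rw [NNReal.mul_rpow]; ring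
    _ ≤ _ := by
        rw [← Finset.mul_sum]
        refine mul_le_mul_right (Finset.sum_le_sum_of_subset fun j hj => ?_) _
        rw [Finset.mem_filter, not_lt] at hj
        rw [Finset.mem_filter]
        refine ⟨hj.1, hj.2.1, lt_of_lt_of_le ?_ hj.2.2⟩
        rw [lt_div_iff₀ (by positivity), mul_comm]
        exact hτ

theorem setLIntegral_le_mul_setLIntegral [MeasurableSpace X] {μ : Measure X} {P Q : Set X}
    (hP : MeasurableSet P) (hQ : MeasurableSet Q) {V : ℝ≥0∞} (hV : μ P ≤ V * μ Q)
    {L R : X → ℝ≥0∞} (h : ∀ x ∈ P, ∀ y ∈ Q, L x ≤ R y) :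
    ∫⁻ x in P, L x ∂μ ≤ V * ∫⁻ y in Q, R y ∂μ := by
  set s := ⨆ x ∈ P, L x
  calc ∫⁻ x in P, L x ∂μ ≤ ∫⁻ _ in P, s ∂μ :=
        setLIntegral_mono' hP fun x hx => le_iSup₂ (f := fun x _ => L x) x hx
    _ = s * μ P := setLIntegral_const _ _
    _ ≤ s * (V * μ Q) := by gcongr
    _ = V * (s * μ Q) := by ring
    _ = V * ∫⁻ _ in Q, s ∂μ := by rw [setLIntegral_const]
    _ ≤ _ := by
        gcongr 1
        exact setLIntegral_mono' hQ fun y hy => iSup₂_le fun x hx => h x hx y hy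

theorem NNReal.mul_rpow_sub_one_le {s t κ : ℝ≥0} (hκ : 0 < κ) (hκ1 : κ ≤ 1) {q Q : ℝ} (hq : 1 ≤ q)
    (hQ : q ≤ Q) : s * t ^ (q - 1) ≤ κ * t ^ q + κ ^ (-Q) * s ^ q := by
  have key : ∀ t : ℝ≥0, t ^ q = t * t ^ (q - 1) := fun t =>
    NNReal.rpow_eq_mul_rpow_sub_one t hq
  rcases le_total s (κ * t) with h | h
  · refine le_add_right ?_
    rw [key t, ← mul_assoc]
    gcongr
  · refine le_add_left ?_
    have h1 : t ≤ κ⁻¹ * s := by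
      rw [← div_eq_inv_mul, le_div_iff₀ hκ, mul_comm]; exact h
    calc s * t ^ (q - 1) ≤ s * (κ⁻¹ * s) ^ (q - 1) := by gcongr
      _ = κ ^ (-(q - 1)) * s ^ q := by
          rw [NNReal.mul_rpow, key s, NNReal.inv_rpow, NNReal.rpow_neg]; ring
      _ ≤ _ := by
          gcongr 1
          exact NNReal.rpow_le_rpow_of_exponent_ge hκ hκ1 (by linarith)

end Nested

/-! ### Cubes -/

theorem cube_eq_preimage {n : ℕ} (z : Rn n) (r : ℝ) :
    cube z r = WithLp.ofLp ⁻¹' (Set.univ.pi fun i => Set.Icc (z i - r / 2) (z i + r / 2)) := by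
  ext x
  simp only [cube, Set.mem_ofPred_eq, Set.mem_preimage, Set.mem_pi, Set.mem_univ, true_imp_iff,
    Set.mem_Icc, abs_le]
  exact forall_congr' fun i => ⟨fun h => ⟨by linarith, by linarith⟩,
    fun h => ⟨by linarith, by linarith⟩⟩

theorem measurableSet_cube {n : ℕ} (z : Rn n) (r : ℝ) : MeasurableSet (cube z r) := by
  rw [cube_eq_preimage]
  exact (PiLp.volume_preserving_ofLp (Fin n)).measurable
    (MeasurableSet.univ_pi fun i => measurableSet_Icc)

theorem volume_cube {n : ℕ} (z : Rn n) (r : ℝ) : volume (cube z r) = ENNReal.ofReal r ^ n := by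
  rw [cube_eq_preimage, (PiLp.volume_preserving_ofLp (Fin n)).measure_preimage
    (MeasurableSet.univ_pi fun i => measurableSet_Icc).nullMeasurableSet, volume_pi_pi]
  simp [Real.volume_Icc]

theorem volume_cube_lt_top {n : ℕ} (z : Rn n) (r : ℝ) : volume (cube z r) < ∞ := by
  rw [volume_cube]
  exact ENNReal.pow_lt_top ENNReal.ofReal_lt_top

theorem cube_subset_cube {n : ℕ} (z : Rn n) {r s : ℝ} (h : r ≤ s) : cube z r ⊆ cube z s :=
  fun x hx i => (hx i).trans (by linarith)

theorem norm_le_of_forall_abs_le {n : ℕ} {x : Rn n} {s : ℝ} (h : ∀ i, |x i| ≤ s) :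
    ‖x‖ ≤ n * s := by
  calc ‖x‖ = ‖∑ i, x i • EuclideanSpace.basisFun (Fin n) ℝ i‖ := by
        congr 1
        exact ((EuclideanSpace.basisFun (Fin n) ℝ).sum_repr x).symm
    _ ≤ ∑ i, ‖x i • EuclideanSpace.basisFun (Fin n) ℝ i‖ := norm_sum_le _ _
    _ ≤ ∑ _i : Fin n, s := Finset.sum_le_sum fun i _ => by
        rw [norm_smul, OrthonormalBasis.norm_eq_one, mul_one]; exact h i
    _ = n * s := by simp

theorem norm_sub_le_of_mem_cube {n : ℕ} {z x y : Rn n} {r : ℝ} (hx : x ∈ cube z r)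
    (hy : y ∈ cube z r) : ‖x - y‖ ≤ n * r := by
  refine norm_le_of_forall_abs_le fun i => ?_
  have h1 := abs_le.1 (hx i)
  have h2 := abs_le.1 (hy i)
  rw [PiLp.sub_apply, abs_le]
  constructor <;> linarith

/-! ### Consequences of log-Hölder continuity -/

theorem Real.rpow_le_exp_mul_rpow {t a b B : ℝ} (ht : 0 < t) (h : (a - b) * Real.log t ≤ B) :
    t ^ a ≤ Real.exp B * t ^ b := by
  rw [Real.rpow_def_of_pos ht, Real.rpow_def_of_pos ht, ← Real.exp_add, Real.exp_le_exp]
  linarith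

theorem LogHolderLocal.continuous {n : ℕ} {q : Rn n → ℝ} (h : LogHolderLocal q) :
    Continuous q := by
  obtain ⟨c, hc, h⟩ := h
  rw [Metric.continuous_iff]
  intro x ε hε
  refine ⟨min (1 / 2) (Real.exp (-(2 * c / ε))), by positivity, fun y hy => ?_⟩
  rw [dist_eq_norm] at hy
  have hy1 : ‖y - x‖ < 1 / 2 := hy.trans_le (min_le_left _ _)
  have hy2 := hy.trans_le (min_le_right _ _)
  rw [Real.dist_eq]
  rcases eq_or_ne y x with rfl | hne
  · simpa using hε
  have h0 : 0 < ‖y - x‖ := norm_pos_iff.2 (sub_ne_zero.2 hne)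
  refine (h y x hy1).trans_lt ?_
  have h3 : Real.log ‖y - x‖ < -(2 * c / ε) := by
    rwa [Real.log_lt_iff_lt_exp h0]
  have h4 : 0 < 2 * c / ε := by positivity
  rw [div_lt_iff₀ (by linarith)]
  have : ε * (2 * c / ε) = 2 * c := by field_simp
  nlinarith

/-- On a set of diameter comparable to `r`, the powers `t ^ q x` with `1 ≤ t ≤ r⁻ⁿ` are
comparable. -/
theorem LogHolderLocal.exists_rpow_le {n : ℕ} {q : Rn n → ℝ} (h : LogHolderLocal q) {Q : ℝ}
    (h1 : ∀ x, 1 ≤ q x) (hQ : ∀ x, q x ≤ Q) {M : ℝ} (hM : 1 ≤ M) :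
    ∃ B : ℝ, ∀ (x y : Rn n) (r t : ℝ), 0 < r → ‖x - y‖ ≤ M * r → 1 ≤ t → t * r ^ n ≤ 1 →
      t ^ (q x - 1) ≤ Real.exp B * t ^ (q y - 1) := by
  obtain ⟨c, hc, h⟩ := h
  have hlM : 0 ≤ Real.log M := Real.log_nonneg hM
  have hl2 : 0 < Real.log 2 := Real.log_pos (by norm_num)
  have hQ1 : 1 ≤ Q := (h1 0).trans (hQ 0)
  refine ⟨c * n * (1 + Real.log M / Real.log 2) + Q * (n * (Real.log M + Real.log 2)),
    fun x y r t hr hxy ht htr => Real.rpow_le_exp_mul_rpow (by linarith) ?_⟩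
  have hb1 : 0 ≤ c * n * (1 + Real.log M / Real.log 2) := by positivity
  have hb2 : 0 ≤ Q * (n * (Real.log M + Real.log 2)) := by positivity
  have hlt : 0 ≤ Real.log t := Real.log_nonneg ht
  have hltr : Real.log t ≤ n * (-Real.log r) := by
    have := Real.log_le_log (by positivity) htr
    rw [Real.log_mul (by positivity) (by positivity), Real.log_pow, Real.log_one] at this
    linarith
  have hn : (0 : ℝ) ≤ n := Nat.cast_nonneg n
  rcases eq_or_ne x y with rfl | hne
  · simp only [sub_self, zero_mul]; linarith
  have h0 : 0 < ‖x - y‖ := norm_pos_iff.2 (sub_ne_zero.2 hne)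
  have hlr : -Real.log r ≤ Real.log M - Real.log ‖x - y‖ := by
    have := Real.log_le_log h0 hxy
    rw [Real.log_mul (by positivity) (by positivity)] at this
    linarith
  have hs : q x - 1 - (q y - 1) ≤ |q x - q y| := by
    have := le_abs_self (q x - q y); linarith
  rcases lt_or_ge ‖x - y‖ (1 / 2) with hlt2 | hge
  · have hl : Real.log 2 ≤ -Real.log ‖x - y‖ := by
      have := Real.log_le_log h0 hlt2.le
      rw [one_div, Real.log_inv] at this
      linarith
    set L := -Real.log ‖x - y‖ with hL
    have hL0 : 0 < L := hl2.trans_le hl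
    calc (q x - 1 - (q y - 1)) * Real.log t ≤ c / L * (n * (Real.log M + L)) := by
          refine mul_le_mul (hs.trans (h x y hlt2)) (hltr.trans ?_) hlt (by positivity)
          gcongr; linarith
      _ = c * n * (1 + Real.log M / L) := by field_simp; ring
      _ ≤ c * n * (1 + Real.log M / Real.log 2) := by gcongr
      _ ≤ _ := by linarith
  · have hl : -Real.log ‖x - y‖ ≤ Real.log 2 := by
      have := Real.log_le_log (by norm_num) hge
      rw [one_div, Real.log_inv] at this
      linarith
    calc (q x - 1 - (q y - 1)) * Real.log t ≤ Q * (n * (Real.log M + Real.log 2)) := by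
          refine mul_le_mul (by linarith [hQ x, h1 y]) (hltr.trans ?_) hlt (by linarith)
          gcongr; linarith
      _ ≤ _ := by linarith

/-- The powers `t ^ q x` are comparable for those `x` with `ε * (1 + ‖x‖) ^ (-(n + 1)) ≤ t ≤ 1`. -/
theorem LogHolderInfty.exists_rpow_le {n : ℕ} {q : Rn n → ℝ} (h : LogHolderInfty q) {ε : ℝ}
    (hε : 0 < ε) (hε1 : ε ≤ 1) :
    ∃ B : ℝ, ∀ (x y : Rn n) (t : ℝ), ε * (1 + ‖x‖) ^ (-(n + 1 : ℝ)) ≤ t →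
      ε * (1 + ‖y‖) ^ (-(n + 1 : ℝ)) ≤ t → t ≤ 1 →
      t ^ (q x - 1) ≤ Real.exp B * t ^ (q y - 1) := by
  obtain ⟨C, hC, pinf, h⟩ := h
  have hlε : Real.log ε ≤ 0 := Real.log_nonpos hε.le hε1
  have key : ∀ (x : Rn n) (t : ℝ), ε * (1 + ‖x‖) ^ (-(n + 1 : ℝ)) ≤ t → t ≤ 1 →
      |q x - pinf| * (-Real.log t) ≤ C * (-Real.log ε + (n + 1)) := by
    intro x t hx ht
    have h1 : 0 < 1 + ‖x‖ := by positivity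
    have hlx := Real.log_le_log (by positivity) hx
    rw [Real.log_mul (by positivity) (by positivity), Real.log_rpow h1] at hlx
    have he : 1 + ‖x‖ ≤ Real.exp 1 + ‖x‖ := by
      have := Real.add_one_le_exp 1; linarith
    have hl1 : Real.log (1 + ‖x‖) ≤ Real.log (Real.exp 1 + ‖x‖) := Real.log_le_log h1 he
    have hl2 : 1 ≤ Real.log (Real.exp 1 + ‖x‖) := by
      rw [Real.le_log_iff_exp_le (by positivity)]; linarith [norm_nonneg x]
    set L := Real.log (Real.exp 1 + ‖x‖)
    have hn : (0 : ℝ) ≤ n := Nat.cast_nonneg n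
    have h2 : -Real.log t ≤ (-Real.log ε + (n + 1)) * L := by nlinarith
    have h3 : 0 ≤ -Real.log t := by
      have := Real.log_nonpos (le_trans (by positivity) hx) ht; linarith
    calc |q x - pinf| * (-Real.log t) ≤ C / L * ((-Real.log ε + (n + 1)) * L) :=
          mul_le_mul (h x) h2 h3 (by positivity)
      _ = C * (-Real.log ε + (n + 1)) := by field_simp
  refine ⟨2 * (C * (-Real.log ε + (n + 1))), fun x y t hx hy ht => ?_⟩
  have ht0 : 0 < t := lt_of_lt_of_le (by positivity) hx
  refine Real.rpow_le_exp_mul_rpow ht0 ?_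
  have h3 : 0 ≤ -Real.log t := by
    have := Real.log_nonpos ht0.le ht; linarith
  have h4 : -(q x - 1 - (q y - 1)) ≤ |q x - pinf| + |q y - pinf| := by
    have := neg_abs_le (q x - pinf)
    have := le_abs_self (q y - pinf)
    linarith
  have := mul_le_mul_of_nonneg_right h4 h3
  have := key x t hx ht
  have := key y t hy ht
  nlinarith

/-- The integrable weight `(1 + ‖x‖) ^ (-(n + 1))` on `ℝⁿ`. -/
noncomputable def decay {n : ℕ} (x : Rn n) : ℝ≥0 := (1 + ‖x‖₊) ^ (-(n + 1 : ℝ))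

theorem decay_le_one {n : ℕ} (x : Rn n) : decay x ≤ 1 :=
  NNReal.rpow_le_one_of_one_le_of_nonpos (by simp) (by linarith [(Nat.cast_nonneg n : (0 : ℝ) ≤ n)])

theorem measurable_decay {n : ℕ} : Measurable (decay : Rn n → ℝ≥0) := by
  unfold decay
  fun_prop

theorem lintegral_decay_lt_top {n : ℕ} : ∫⁻ x : Rn n, (decay x : ℝ≥0∞) < ∞ := by
  have := finite_integral_one_add_norm (E := Rn n) (μ := volume) (r := n + 1) (by simp)
  convert this using 3 with x
  rw [← ENNReal.ofReal_coe_nnreal]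
  simp [decay]

/-! ### The modular inequality for nested families -/

/-- A nested family of measurable sets `P j`, comparable to the cubes `Q(z j, r j)`. -/
structure NestedCover {ι : Type*} {n : ℕ} (M : ℝ) (S : Finset ι) (z : ι → Rn n) (r : ι → ℝ)
    (P : ι → Set (Rn n)) : Prop where
  nested : NestedOn S P
  measurableSet : ∀ j ∈ S, MeasurableSet (P j)
  pos : ∀ j ∈ S, 0 < r j
  cube_subset : ∀ j ∈ S, cube (z j) (r j) ⊆ P j
  subset_cube : ∀ j ∈ S, P j ⊆ cube (z j) (M * r j)

/-- The modular `∫ (∑ j ∈ S, a j * 1_{P j}) ^ q`. -/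
noncomputable def stepModular {ι : Type*} {n : ℕ} (q : Rn n → ℝ) (S : Finset ι) (a : ι → ℝ≥0)
    (P : ι → Set (Rn n)) : ℝ≥0∞ :=
  ∫⁻ x, ((stepFun S a P x ^ q x : ℝ≥0) : ℝ≥0∞)

theorem exists_rpow_le_add_indicator {n : ℕ} {q : Rn n → ℝ} (hloc : LogHolderLocal q)
    (hinf : LogHolderInfty q) {Q : ℝ} (h1 : ∀ x, 1 ≤ q x) (hQ : ∀ x, q x ≤ Q) {M : ℝ} (hM : 1 ≤ M)
    {ε : ℝ≥0} (hε : 0 < ε) (hε1 : ε ≤ 1) :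
    ∃ C : ℝ≥0, ∀ (x y : Rn n) (r : ℝ) (t : ℝ≥0), 0 < r → ‖x - y‖ ≤ M * r →
      (1 ≤ t → t * r ^ n ≤ 1) → ε * decay x < t →
      t ^ (q x - 1) ≤ C * t ^ (q y - 1) + if t < ε * decay y then 1 else 0 := by
  obtain ⟨B₁, hB₁⟩ := hloc.exists_rpow_le h1 hQ hM
  obtain ⟨B₂, hB₂⟩ := hinf.exists_rpow_le (ε := ε) (by exact_mod_cast hε) (by exact_mod_cast hε1)
  refine ⟨Real.toNNReal (Real.exp (max B₁ B₂)), fun x y r t hr hxy htr ht => ?_⟩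
  have hcoe : ∀ x : Rn n, ((decay x : ℝ≥0) : ℝ) = (1 + ‖x‖) ^ (-(n + 1 : ℝ)) := fun x => by
    simp [decay]
  have mono : ∀ B, B ≤ max B₁ B₂ → (t : ℝ) ^ (q x - 1) ≤ Real.exp B * (t : ℝ) ^ (q y - 1) →
      t ^ (q x - 1) ≤ Real.toNNReal (Real.exp (max B₁ B₂)) * t ^ (q y - 1) := by
    intro B hB h
    rw [← NNReal.coe_le_coe]
    rw [NNReal.coe_mul, NNReal.coe_rpow, NNReal.coe_rpow, Real.coe_toNNReal _ (Real.exp_pos _).le]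
    exact h.trans (mul_le_mul_of_nonneg_right (Real.exp_le_exp.2 hB) (by positivity))
  rcases le_total 1 t with h | h
  · exact le_add_right (mono B₁ (le_max_left _ _)
      (hB₁ x y r t hr hxy (by exact_mod_cast h) (htr h)))
  · split_ifs with h2
    · exact le_add_left (NNReal.rpow_le_one h (by linarith [h1 x]))
    · rw [not_lt] at h2
      refine le_add_right (mono B₂ (le_max_right _ _) (hB₂ x y t ?_ ?_ (by exact_mod_cast h)))
      · rw [← hcoe]; exact_mod_cast ht.le
      · rw [← hcoe]; exact_mod_cast h2

section

variable {ι : Type*} {n : ℕ} {q : Rn n → ℝ} {S : Finset ι} {a : ι → ℝ≥0} {z : ι → Rn n}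
  {r : ι → ℝ} {P : ι → Set (Rn n)} {M Q : ℝ}

theorem NestedCover.aboveSum_mul_le (h : NestedCover M S z r P) (h1 : ∀ x, 1 ≤ q x)
    (hF : stepModular q S a P ≤ 1) {j : ι} (hj : j ∈ S) (hG : 1 ≤ aboveSum S a P j) :
    (aboveSum S a P j : ℝ) * r j ^ n ≤ 1 := by
  have hr := h.pos j hj
  have : (aboveSum S a P j : ℝ≥0∞) * ENNReal.ofReal (r j) ^ n ≤ 1 := by
    rw [← volume_cube (z j), ← setLIntegral_const]
    refine le_trans (le_trans (setLIntegral_mono' (measurableSet_cube _ _) fun x hx => ?_)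
      (setLIntegral_le_lintegral _ _)) hF
    have hle := aboveSum_le_stepFun S a P (h.cube_subset j hj hx)
    rw [ENNReal.coe_le_coe]
    calc aboveSum S a P j = aboveSum S a P j ^ (1 : ℝ) := by simp
      _ ≤ aboveSum S a P j ^ q x := NNReal.rpow_le_rpow_of_exponent_le hG (h1 x)
      _ ≤ _ := NNReal.rpow_le_rpow hle (by linarith [h1 x])
  rw [← ENNReal.ofReal_pow hr.le, ← ENNReal.ofReal_coe_nnreal, ← ENNReal.ofReal_mul (by simp),
    ENNReal.ofReal_le_one] at this
  exact this

theorem NestedCover.volume_le (h : NestedCover M S z r P) (hM : 1 ≤ M) {j : ι} (hj : j ∈ S) :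
    volume (P j) ≤ ENNReal.ofReal M ^ n * volume (cube (z j) (r j)) := by
  refine (measure_mono (h.subset_cube j hj)).trans ?_
  rw [volume_cube, volume_cube, ENNReal.ofReal_mul (by linarith), mul_pow]

open Classical in
theorem NestedCover.rpow_stepFun_le (h : NestedCover M S z r P) (h1 : ∀ x, 1 ≤ q x)
    (hQ : ∀ x, q x ≤ Q) {E : Rn n → ℝ≥0} (hE : ∀ x, 2 * E x ≤ 1) (x : Rn n) :
    stepFun S a P x ^ q x ≤ 2 * E x + 2 ^ Q * ∑ j ∈ S, (P j).indicator
      (fun x => if E x < aboveSum S a P j then a j * aboveSum S a P j ^ (q x - 1) else 0) x := by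
  rcases le_or_gt (stepFun S a P x) (2 * E x) with hle | hlt
  · refine le_add_right ?_
    calc stepFun S a P x ^ q x ≤ (2 * E x) ^ q x :=
          NNReal.rpow_le_rpow hle (by linarith [h1 x])
      _ ≤ (2 * E x) ^ (1 : ℝ) := by
          rcases eq_or_ne (E x) 0 with h0 | h0
          · simp [h0, NNReal.zero_rpow (by linarith [h1 x] : q x ≠ 0)]
          · exact NNReal.rpow_le_rpow_of_exponent_ge (by positivity) (hE x) (h1 x)
      _ = 2 * E x := by simp
  · refine le_add_left ((h.nested.rpow_stepFun_le a x hlt (h1 x)).trans ?_)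
    refine mul_le_mul' (NNReal.rpow_le_rpow_of_exponent_le (by norm_num) (hQ x)) (le_of_eq ?_)
    rw [Finset.sum_filter]
    refine Finset.sum_congr rfl fun j _ => ?_
    by_cases hx : x ∈ P j <;> simp [hx]

open Classical in
theorem NestedCover.sum_indicator_le (h : NestedCover M S z r P) (h1 : ∀ x, 1 ≤ q x)
    (C : ℝ≥0) (E : Rn n → ℝ≥0) (y : Rn n) :
    ∑ j ∈ S, (cube (z j) (r j)).indicator (fun y => a j * (C * aboveSum S a P j ^ (q y - 1) +
      if aboveSum S a P j < E y then 1 else 0)) y ≤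
    C * (stepFun S a (fun j => cube (z j) (r j)) y * stepFun S a P y ^ (q y - 1)) + E y := by
  have e1 : C * (stepFun S a (fun j => cube (z j) (r j)) y * stepFun S a P y ^ (q y - 1)) =
      ∑ j ∈ S, (cube (z j) (r j)).indicator
        (fun y => a j * (C * stepFun S a P y ^ (q y - 1))) y := by
    rw [stepFun, Finset.sum_mul, Finset.mul_sum]
    refine Finset.sum_congr rfl fun j _ => ?_
    by_cases hy : y ∈ cube (z j) (r j) <;> simp [hy]; ring
  refine le_trans ?_ (add_le_add_right (h.nested.sum_filter_aboveSum_lt_le a y (E y)) _)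
  rw [e1, Finset.sum_filter, ← Finset.sum_add_distrib]
  refine Finset.sum_le_sum fun j hj => ?_
  by_cases hy : y ∈ cube (z j) (r j)
  · have hyP := h.cube_subset j hj hy
    have : aboveSum S a P j ^ (q y - 1) ≤ stepFun S a P y ^ (q y - 1) :=
      NNReal.rpow_le_rpow (aboveSum_le_stepFun S a P hyP) (by linarith [h1 y])
    simp only [Set.indicator_of_mem hy, hyP, true_and]
    rw [mul_add]
    gcongr
    split_ifs <;> simp
  · simp [hy]

theorem exists_stepModular_le (hloc : LogHolderLocal q) (hinf : LogHolderInfty q)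
    (h1 : ∀ x, 1 ≤ q x) (hQ : ∀ x, q x ≤ Q) (hn : 0 < n) (hM : 1 ≤ M) {ε : ℝ≥0} (hε : 0 < ε)
    (hε1 : 2 * ε ≤ 1) :
    ∃ C : ℝ≥0, ∀ (S : Finset ι) (a : ι → ℝ≥0) (z : ι → Rn n) (r : ι → ℝ) (P : ι → Set (Rn n)),
      NestedCover M S z r P → stepModular q S a P ≤ 1 →
      stepModular q S a P ≤ (2 + 2 ^ Q * Real.toNNReal M ^ n : ℝ≥0) * (ε * ∫⁻ x : Rn n, decay x) +
        C * ∫⁻ x, ((stepFun S a (fun j => cube (z j) (r j)) x *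
          stepFun S a P x ^ (q x - 1) : ℝ≥0) : ℝ≥0∞) := by
  classical
  have hqm : Measurable q := hloc.continuous.measurable
  have hnM : 1 ≤ n * M := by
    have : (1 : ℝ) ≤ n := by exact_mod_cast hn
    nlinarith
  have hε1' : ε ≤ 1 := by
    refine le_trans ?_ hε1
    exact le_mul_of_one_le_left (by positivity) (by norm_num)
  obtain ⟨C, hC⟩ := exists_rpow_le_add_indicator hloc hinf h1 hQ hnM hε hε1'
  set V : ℝ≥0 := Real.toNNReal M ^ n with hV
  refine ⟨2 ^ Q * V * C, fun S a z r P h hF => ?_⟩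
  set G := aboveSum S a P with hG
  set E : Rn n → ℝ≥0 := fun x => ε * decay x with hE
  have hEm : Measurable E := measurable_decay.const_mul ε
  have hPow : ∀ j, Measurable fun x => G j ^ (q x - 1) := fun j =>
    measurable_const.pow (hqm.sub_const 1)
  set L : ι → Rn n → ℝ≥0 := fun j => (P j).indicator
      (fun x => if E x < G j then a j * G j ^ (q x - 1) else 0) with hL
  set R : ι → Rn n → ℝ≥0 := fun j => (cube (z j) (r j)).indicator
      (fun y => a j * (C * G j ^ (q y - 1) + if G j < E y then 1 else 0)) with hR
  have hLm : ∀ j ∈ S, Measurable (L j) := fun j hj =>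
    (Measurable.ite (measurableSet_lt hEm measurable_const) ((hPow j).const_mul _)
      measurable_const).indicator (h.measurableSet j hj)
  have hRm : ∀ j ∈ S, Measurable (R j) := fun j hj =>
    ((((hPow j).const_mul _).add (Measurable.ite (measurableSet_lt measurable_const hEm)
      measurable_const measurable_const)).const_mul _).indicator (measurableSet_cube _ _)
  have hLR : ∀ j ∈ S, ∫⁻ x, (L j x : ℝ≥0∞) ≤ V * ∫⁻ x, (R j x : ℝ≥0∞) := by
    intro j hj
    have e1 : ∫⁻ x, (L j x : ℝ≥0∞) = ∫⁻ x in P j,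
        ((if E x < G j then a j * G j ^ (q x - 1) else 0 : ℝ≥0) : ℝ≥0∞) := by
      rw [← lintegral_indicator (h.measurableSet j hj)]
      refine lintegral_congr fun x => ?_
      by_cases hx : x ∈ P j <;> simp [hL, hx]
    have e2 : ∫⁻ x, (R j x : ℝ≥0∞) = ∫⁻ y in cube (z j) (r j),
        ((a j * (C * G j ^ (q y - 1) + if G j < E y then 1 else 0) : ℝ≥0) : ℝ≥0∞) := by
      rw [← lintegral_indicator (measurableSet_cube _ _)]
      refine lintegral_congr fun x => ?_
      by_cases hx : x ∈ cube (z j) (r j) <;> simp [hR, hx]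
    rw [e1, e2]
    refine setLIntegral_le_mul_setLIntegral (h.measurableSet j hj) (measurableSet_cube _ _)
      ?_ fun x hx y hy => ?_
    · rw [hV, ENNReal.coe_pow]; exact h.volume_le hM hj
    · rw [ENNReal.coe_le_coe]
      by_cases h2 : E x < G j
      · rw [if_pos h2]
        refine mul_le_mul_right ?_ _
        refine hC x y (r j) (G j) (h.pos j hj) ?_ (h.aboveSum_mul_le h1 hF hj) h2
        rw [mul_assoc]
        exact norm_sub_le_of_mem_cube (h.subset_cube j hj hx)
          (h.subset_cube j hj (h.cube_subset j hj hy))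
      · rw [if_neg h2]; exact zero_le
  have hJ : ∫⁻ x, (E x : ℝ≥0∞) = ε * ∫⁻ x : Rn n, decay x := by
    rw [← lintegral_const_mul _ measurable_decay.coe_nnreal_ennreal]
    simp [hE]
  rw [← hJ]
  set H : Rn n → ℝ≥0 := fun x =>
    stepFun S a (fun j => cube (z j) (r j)) x * stepFun S a P x ^ (q x - 1) with hH
  have hHm : Measurable H :=
    (measurable_stepFun S a fun j _ => measurableSet_cube _ _).mul
      ((measurable_stepFun S a h.measurableSet).pow (hqm.sub_const 1))
  calc stepModular q S a P
      ≤ ∫⁻ x, (2 * (E x : ℝ≥0∞) + (2 ^ Q : ℝ≥0) * ∑ j ∈ S, (L j x : ℝ≥0∞)) := by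
        refine lintegral_mono fun x => ?_
        have hE1 : ∀ x, 2 * E x ≤ 1 := fun x => by
          refine le_trans ?_ hε1
          gcongr
          exact mul_le_of_le_one_right (by positivity) (decay_le_one x)
        have h2 : stepFun S a P x ^ q x ≤ 2 * E x + 2 ^ Q * ∑ j ∈ S, L j x :=
          h.rpow_stepFun_le (a := a) h1 hQ hE1 x
        exact (ENNReal.coe_le_coe.2 h2).trans_eq (by push_cast; rfl)
    _ = 2 * (∫⁻ x, (E x : ℝ≥0∞)) + (2 ^ Q : ℝ≥0) * ∑ j ∈ S, ∫⁻ x, (L j x : ℝ≥0∞) := by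
        rw [lintegral_add_left (hEm.coe_nnreal_ennreal.const_mul _),
          lintegral_const_mul _ hEm.coe_nnreal_ennreal, lintegral_const_mul,
          lintegral_finsetSum _ fun j hj => (hLm j hj).coe_nnreal_ennreal]
        exact Finset.measurable_sum _ fun j hj => (hLm j hj).coe_nnreal_ennreal
    _ ≤ 2 * (∫⁻ x, (E x : ℝ≥0∞)) + (2 ^ Q : ℝ≥0) * ∑ j ∈ S, V * ∫⁻ x, (R j x : ℝ≥0∞) := by
        refine add_le_add_right (mul_le_mul_right (Finset.sum_le_sum fun j hj => ?_) _) _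
        exact hLR j hj
    _ = 2 * (∫⁻ x, (E x : ℝ≥0∞)) + (2 ^ Q : ℝ≥0) * (V * ∫⁻ x, ∑ j ∈ S, (R j x : ℝ≥0∞)) := by
        rw [← Finset.mul_sum, lintegral_finsetSum _ fun j hj => (hRm j hj).coe_nnreal_ennreal]
    _ ≤ 2 * (∫⁻ x, (E x : ℝ≥0∞)) + (2 ^ Q : ℝ≥0) * (V * ∫⁻ x, (C * (H x : ℝ≥0∞) + E x)) := by
        gcongr with x
        have h2 : ∑ j ∈ S, R j x ≤ C * H x + E x := h.sum_indicator_le (a := a) h1 C E x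
        exact_mod_cast h2
    _ = _ := by
        rw [lintegral_add_left (hHm.coe_nnreal_ennreal.const_mul _),
          lintegral_const_mul _ hHm.coe_nnreal_ennreal]
        change _ = _ + _ * ∫⁻ x, (H x : ℝ≥0∞)
        simp only [ENNReal.coe_add, ENNReal.coe_mul, ENNReal.coe_ofNat]
        ring

end

section

variable {ι : Type*} {n : ℕ} {q : Rn n → ℝ} {M Q : ℝ}

theorem NNReal.mul_div_three_mul_le (B η : ℝ≥0) : B * (η / (3 * (B + 1))) ≤ η / 3 := by
  have : B * (η / (3 * (B + 1))) = η / 3 * (B / (B + 1)) := by field_simp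
  rw [this]
  refine mul_le_of_le_one_right (by positivity) ?_
  rw [div_le_one (by positivity)]
  simp

/-- If the modular of the inner step function is small and that of the outer one is at most `1`,
then the latter is small as well. -/
theorem exists_stepModular_le_of_le (hloc : LogHolderLocal q) (hinf : LogHolderInfty q)
    (h1 : ∀ x, 1 ≤ q x) (hQ : ∀ x, q x ≤ Q) (hn : 0 < n) (hM : 1 ≤ M) {η : ℝ≥0} (hη : 0 < η) :
    ∃ δ : ℝ≥0, 0 < δ ∧ ∀ (S : Finset ι) (a : ι → ℝ≥0) (z : ι → Rn n) (r : ι → ℝ)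
      (P : ι → Set (Rn n)), NestedCover M S z r P →
      stepModular q S a (fun j => cube (z j) (r j)) ≤ δ → stepModular q S a P ≤ 1 →
      stepModular q S a P ≤ η := by
  have hqm : Measurable q := hloc.continuous.measurable
  set A : ℝ≥0 := 2 + 2 ^ Q * Real.toNNReal M ^ n with hA
  obtain ⟨J, hJ⟩ : ∃ J : ℝ≥0, (J : ℝ≥0∞) = ∫⁻ x : Rn n, (decay x : ℝ≥0∞) :=
    ⟨_, ENNReal.coe_toNNReal lintegral_decay_lt_top.ne⟩
  set ε : ℝ≥0 := min (1 / 2) (η / (3 * (A * J + 1))) with hε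
  have hε0 : 0 < ε := lt_min (by norm_num) (by positivity)
  have hε1 : 2 * ε ≤ 1 := by
    calc 2 * ε ≤ 2 * (1 / 2) := by gcongr; exact min_le_left _ _
      _ = 1 := by norm_num
  have hAε : A * (ε * J) ≤ η / 3 := by
    calc A * (ε * J) = A * J * ε := by ring
      _ ≤ A * J * (η / (3 * (A * J + 1))) := by gcongr; exact min_le_right _ _
      _ ≤ _ := NNReal.mul_div_three_mul_le _ _
  obtain ⟨C, hC⟩ := exists_stepModular_le (ι := ι) hloc hinf h1 hQ hn hM hε0 hε1
  set κ : ℝ≥0 := min 1 (η / (3 * (C + 1))) with hκ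
  have hκ0 : 0 < κ := lt_min (by norm_num) (by positivity)
  have hCκ : C * κ ≤ η / 3 := by
    calc C * κ ≤ C * (η / (3 * (C + 1))) := by gcongr; exact min_le_right _ _
      _ ≤ _ := NNReal.mul_div_three_mul_le _ _
  set D : ℝ≥0 := C * κ ^ (-Q) with hD
  refine ⟨η / (3 * (D + 1)), by positivity, fun S a z r P h hf hF => (hC S a z r P h hF).trans ?_⟩
  set f := stepFun S a (fun j => cube (z j) (r j)) with hfdef
  have hfm : Measurable f := measurable_stepFun S a fun j _ => measurableSet_cube _ _
  have hFm : Measurable (stepFun S a P) := measurable_stepFun S a h.measurableSet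
  have hH : ∫⁻ x, ((f x * stepFun S a P x ^ (q x - 1) : ℝ≥0) : ℝ≥0∞) ≤
      κ * stepModular q S a P + (κ ^ (-Q) : ℝ≥0) *
        stepModular q S a (fun j => cube (z j) (r j)) := by
    rw [stepModular, stepModular,
      ← lintegral_const_mul _ (hFm.pow hqm).coe_nnreal_ennreal,
      ← lintegral_const_mul _ (hfm.pow hqm).coe_nnreal_ennreal,
      ← lintegral_add_left ((hFm.pow hqm).coe_nnreal_ennreal.const_mul _)]
    refine lintegral_mono fun x => ?_
    have := NNReal.mul_rpow_sub_one_le (s := f x) (t := stepFun S a P x) hκ0 (min_le_left _ _)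
      (h1 x) (hQ x)
    exact (ENNReal.coe_le_coe.2 this).trans_eq (by
      rw [ENNReal.coe_add, ENNReal.coe_mul, ENNReal.coe_mul])
  rw [← hJ]
  calc (A : ℝ≥0∞) * (ε * J) + C * ∫⁻ x, ((f x * stepFun S a P x ^ (q x - 1) : ℝ≥0) : ℝ≥0∞)
      ≤ (A * (ε * J) : ℝ≥0∞) +
        C * (κ * 1 + (κ ^ (-Q) : ℝ≥0) * (η / (3 * (D + 1)) : ℝ≥0)) := by
        gcongr
        refine hH.trans ?_
        gcongr
    _ = ((A * (ε * J) + C * κ + D * (η / (3 * (D + 1))) : ℝ≥0) : ℝ≥0∞) := by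
        simp only [hD, ENNReal.coe_add, ENNReal.coe_mul]
        ring
    _ ≤ ((η / 3 + η / 3 + η / 3 : ℝ≥0) : ℝ≥0∞) := by
        rw [ENNReal.coe_le_coe]
        gcongr
        exact NNReal.mul_div_three_mul_le _ _
    _ = η := by
        congr 1
        field_simp
        norm_num

theorem stepModular_smul_le_of_le_one (h1 : ∀ x, 1 ≤ q x) (S : Finset ι) (a : ι → ℝ≥0)
    (P : ι → Set (Rn n)) {s : ℝ≥0} (hs : s ≤ 1) :
    stepModular q S (fun j => s * a j) P ≤ s * stepModular q S a P := by
  rw [stepModular, stepModular, ← lintegral_const_mul' _ _ ENNReal.coe_ne_top]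
  refine lintegral_mono fun x => ?_
  rw [stepFun_smul, NNReal.mul_rpow, ← ENNReal.coe_mul, ENNReal.coe_le_coe]
  refine mul_le_mul_left ?_ _
  rcases eq_or_ne s 0 with rfl | h0
  · simp [NNReal.zero_rpow (by linarith [h1 x] : q x ≠ 0)]
  · calc s ^ q x ≤ s ^ (1 : ℝ) := NNReal.rpow_le_rpow_of_exponent_ge (by positivity) hs (h1 x)
      _ = s := by simp

theorem stepModular_smul_le_of_one_le (hQ : ∀ x, q x ≤ Q) (S : Finset ι) (a : ι → ℝ≥0)
    (P : ι → Set (Rn n)) {s : ℝ≥0} (hs : 1 ≤ s) :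
    stepModular q S (fun j => s * a j) P ≤ (s ^ Q : ℝ≥0) * stepModular q S a P := by
  rw [stepModular, stepModular, ← lintegral_const_mul' _ _ ENNReal.coe_ne_top]
  refine lintegral_mono fun x => ?_
  rw [stepFun_smul, NNReal.mul_rpow, ← ENNReal.coe_mul, ENNReal.coe_le_coe]
  exact mul_le_mul_left (NNReal.rpow_le_rpow_of_exponent_le hs (hQ x)) _

theorem NestedCover.stepModular_lt_top {S : Finset ι} {z : ι → Rn n} {r : ι → ℝ}
    {P : ι → Set (Rn n)} (h : NestedCover M S z r P) (h1 : ∀ x, 1 ≤ q x) (hQ : ∀ x, q x ≤ Q)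
    (a : ι → ℝ≥0) : stepModular q S a P < ∞ := by
  set B : ℝ≥0 := (1 + ∑ j ∈ S, a j) ^ Q with hB
  have key : ∀ x, stepFun S a P x ^ q x ≤ B * ∑ j ∈ S, (P j).indicator (fun _ => 1) x := by
    intro x
    by_cases hx : ∃ j ∈ S, x ∈ P j
    · obtain ⟨j, hj, hx⟩ := hx
      have e1 : (1 : ℝ≥0) ≤ ∑ j ∈ S, (P j).indicator (fun _ => 1) x := by
        refine le_trans ?_ (Finset.single_le_sum (f := fun j => (P j).indicator (fun _ => 1) x)
          (fun _ _ => zero_le) hj)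
        simp [hx]
      have e2 : stepFun S a P x ≤ 1 + ∑ j ∈ S, a j := by
        refine le_add_left (Finset.sum_le_sum fun j _ => ?_)
        exact Set.indicator_le_self' (fun _ _ => zero_le) x
      calc stepFun S a P x ^ q x ≤ (1 + ∑ j ∈ S, a j) ^ q x :=
            NNReal.rpow_le_rpow e2 (by linarith [h1 x])
        _ ≤ B := NNReal.rpow_le_rpow_of_exponent_le (by simp) (hQ x)
        _ ≤ _ := le_mul_of_one_le_right zero_le e1
    · have : stepFun S a P x = 0 := Finset.sum_eq_zero fun j hj =>
        Set.indicator_of_notMem (fun h => hx ⟨j, hj, h⟩) _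
      rw [this, NNReal.zero_rpow (by linarith [h1 x])]
      exact zero_le
  calc stepModular q S a P
      ≤ ∫⁻ x, B * ∑ j ∈ S, (P j).indicator (fun _ => (1 : ℝ≥0∞)) x := by
        refine lintegral_mono fun x => ?_
        refine (ENNReal.coe_le_coe.2 (key x)).trans_eq ?_
        push_cast
        rfl
    _ = B * ∑ j ∈ S, volume (P j) := by
        rw [lintegral_const_mul' _ _ ENNReal.coe_ne_top, lintegral_finsetSum]
        · congr 1
          refine Finset.sum_congr rfl fun j hj => ?_
          rw [lintegral_indicator_const (h.measurableSet j hj), one_mul]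
        · exact fun j hj => measurable_const.indicator (h.measurableSet j hj)
    _ < ∞ := by
        refine ENNReal.mul_lt_top ENNReal.coe_lt_top (ENNReal.sum_lt_top.2 fun j hj => ?_)
        exact (measure_mono (h.subset_cube j hj)).trans_lt (volume_cube_lt_top _ _)

theorem exists_stepModular_smul_le_one (hloc : LogHolderLocal q) (hinf : LogHolderInfty q)
    (h1 : ∀ x, 1 ≤ q x) (hQ : ∀ x, q x ≤ Q) (hn : 0 < n) (hM : 1 ≤ M) :
    ∃ c : ℝ≥0, 0 < c ∧ ∀ (S : Finset ι) (a : ι → ℝ≥0) (z : ι → Rn n) (r : ι → ℝ)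
      (P : ι → Set (Rn n)), NestedCover M S z r P →
      stepModular q S a (fun j => cube (z j) (r j)) ≤ 1 →
      stepModular q S (fun j => c * a j) P ≤ 1 := by
  obtain ⟨δ, hδ, H⟩ := exists_stepModular_le_of_le (ι := ι) hloc hinf h1 hQ hn hM
    (η := (2 ^ Q)⁻¹) (by positivity)
  set c : ℝ≥0 := min 1 δ with hc
  have hc0 : 0 < c := lt_min one_pos hδ
  refine ⟨c, hc0, fun S a z r P h hf => ?_⟩
  have down : ∀ k : ℕ, stepModular q S (fun j => c * (1 / 2) ^ k * a j) P ≤ 1 →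
      stepModular q S (fun j => c * a j) P ≤ 1 := by
    intro k
    induction k with
    | zero => simp
    | succ k ih =>
      intro hk
      apply ih
      have hs : c * (1 / 2) ^ (k + 1) ≤ c :=
        mul_le_of_le_one_right zero_le (pow_le_one₀ zero_le (by norm_num))
      have hfk : stepModular q S (fun j => c * (1 / 2) ^ (k + 1) * a j)
          (fun j => cube (z j) (r j)) ≤ δ := by
        refine (stepModular_smul_le_of_le_one h1 S a _ (hs.trans (min_le_left _ _))).trans ?_
        calc _ ≤ ((c * (1 / 2) ^ (k + 1) : ℝ≥0) : ℝ≥0∞) * 1 := by gcongr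
          _ ≤ δ := by
            rw [mul_one, ENNReal.coe_le_coe]
            exact hs.trans (min_le_right _ _)
      have hle := H S _ z r P h hfk hk
      have e : (fun j => c * (1 / 2) ^ k * a j) =
          fun j => 2 * (c * (1 / 2) ^ (k + 1) * a j) := by
        funext j
        rw [pow_succ]
        field_simp
      rw [e]
      refine (stepModular_smul_le_of_one_le hQ S _ P (s := 2) (by norm_num)).trans ?_
      calc _ ≤ ((2 ^ Q : ℝ≥0) : ℝ≥0∞) * (((2 ^ Q)⁻¹ : ℝ≥0) : ℝ≥0∞) := by gcongr
        _ = 1 := by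
          rw [← ENNReal.coe_mul, mul_inv_cancel₀ (by positivity), ENNReal.coe_one]
  obtain ⟨B, hB⟩ : ∃ B : ℝ≥0, (B : ℝ≥0∞) = stepModular q S a P :=
    ⟨_, ENNReal.coe_toNNReal (h.stepModular_lt_top h1 hQ a).ne⟩
  obtain ⟨k, hk⟩ := NNReal.exists_pow_lt_of_lt_one (a := (B + 1)⁻¹) (by positivity)
    (b := 1 / 2) (by norm_num)
  apply down k
  have hs : c * (1 / 2) ^ k ≤ (1 / 2) ^ k := mul_le_of_le_one_left zero_le (min_le_left _ _)
  refine (stepModular_smul_le_of_le_one h1 S a P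
    (hs.trans (pow_le_one₀ zero_le (by norm_num)))).trans ?_
  rw [← hB, ← ENNReal.coe_mul, ENNReal.coe_le_one_iff]
  calc c * (1 / 2) ^ k * B ≤ (B + 1)⁻¹ * (B + 1) := by
        gcongr
        · exact hs.trans hk.le
        · simp
    _ = 1 := inv_mul_cancel₀ (by positivity)

end

/-! ### Shifted dyadic grids -/

/-- The offset of the shifted grid of mesh `2 ^ k`, in units of the mesh. -/
noncomputable def gridShift (b : Bool) (k : ℤ) : ℝ :=
  if b then (if Even k then 1 / 3 else 2 / 3) else 0

/-- The index of the cell of mesh `2 ^ k` that contains `x`. -/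
noncomputable def gridIndex {n : ℕ} (τ : Fin n → Bool) (k : ℤ) (x : Rn n) (i : Fin n) : ℤ :=
  ⌊x i / 2 ^ k + gridShift (τ i) k⌋

/-- The cell of mesh `2 ^ k` that contains `z`. -/
def gridCell {n : ℕ} (τ : Fin n → Bool) (k : ℤ) (z : Rn n) : Set (Rn n) :=
  {x | ∀ i, gridIndex τ k x i = gridIndex τ k z i}

theorem two_mul_gridShift_succ (b : Bool) (k : ℤ) :
    ∃ m : ℤ, 2 * gridShift b (k + 1) = gridShift b k + m := by
  rcases b with _ | _
  · exact ⟨0, by simp [gridShift]⟩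
  · by_cases hk : Even k
    · have : ¬ Even (k + 1) := by simpa [Int.even_add_one] using hk
      exact ⟨1, by simp [gridShift, hk, this]; norm_num⟩
    · have : Even (k + 1) := by simpa [Int.even_add_one] using hk
      exact ⟨0, by simp [gridShift, hk, this, div_eq_mul_inv]⟩

theorem gridIndex_succ_congr {n : ℕ} {τ : Fin n → Bool} {k : ℤ} {x y : Rn n} {i : Fin n}
    (h : gridIndex τ k x i = gridIndex τ k y i) :
    gridIndex τ (k + 1) x i = gridIndex τ (k + 1) y i := by
  obtain ⟨m, hm⟩ := two_mul_gridShift_succ (τ i) k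
  have key : ∀ x : Rn n, x i / 2 ^ (k + 1) + gridShift (τ i) (k + 1) =
      (x i / 2 ^ k + gridShift (τ i) k + m) / 2 := fun x => by
    rw [add_assoc, ← hm, zpow_add_one₀ (by norm_num)]
    field_simp
  unfold gridIndex at *
  rw [key x, key y]
  set v := x i / 2 ^ k + gridShift (τ i) k
  set w := y i / 2 ^ k + gridShift (τ i) k
  set N := ⌊(w + m) / 2⌋ with hN
  have h1 : (N : ℝ) ≤ (w + m) / 2 := Int.floor_le _
  have h2 : (w + m) / 2 < N + 1 := Int.lt_floor_add_one _
  have h3 : 2 * N - m ≤ ⌊w⌋ := Int.le_floor.2 (by push_cast; linarith)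
  have h4 : ⌊w⌋ < 2 * N + 2 - m := Int.floor_lt.2 (by push_cast; linarith)
  rw [← h] at h3 h4
  have h5 := Int.le_floor.1 h3
  have h6 := Int.floor_lt.1 h4
  push_cast at h5 h6
  rw [Int.floor_eq_iff]
  constructor <;> linarith

theorem gridIndex_congr_of_le {n : ℕ} {τ : Fin n → Bool} {k l : ℤ} (hkl : k ≤ l) {x y : Rn n}
    {i : Fin n} (h : gridIndex τ k x i = gridIndex τ k y i) :
    gridIndex τ l x i = gridIndex τ l y i := by
  induction l, hkl using Int.leInduction with
  | base => exact h
  | succ l _ ih => exact gridIndex_succ_congr ih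

theorem gridCell_subset_or_disjoint {n : ℕ} (τ : Fin n → Bool) {k l : ℤ} (hkl : k ≤ l)
    (z w : Rn n) :
    gridCell τ k z ⊆ gridCell τ l w ∨ Disjoint (gridCell τ k z) (gridCell τ l w) := by
  rw [or_iff_not_imp_right, Set.not_disjoint_iff]
  rintro ⟨x, hx, hx'⟩ y hy i
  rw [← hx' i]
  exact gridIndex_congr_of_le hkl ((hy i).trans (hx i).symm)

theorem measurableSet_gridCell {n : ℕ} (τ : Fin n → Bool) (k : ℤ) (z : Rn n) :
    MeasurableSet (gridCell τ k z) := by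
  have : gridCell τ k z = ⋂ i, {x | gridIndex τ k x i = gridIndex τ k z i} := by
    ext x; simp [gridCell]
  rw [this]
  refine MeasurableSet.iInter fun i => measurableSet_eq_fun ?_ measurable_const
  unfold gridIndex
  fun_prop

theorem gridCell_subset_cube {n : ℕ} (τ : Fin n → Bool) (k : ℤ) (z : Rn n) :
    gridCell τ k z ⊆ cube z (2 * 2 ^ k) := by
  intro x hx i
  have h := Int.abs_sub_lt_one_of_floor_eq_floor (hx i)
  have h2 : (0 : ℝ) < 2 ^ k := by positivity
  have e : x i / 2 ^ k + gridShift (τ i) k - (z i / 2 ^ k + gridShift (τ i) k) =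
      (x i - z i) / 2 ^ k := by ring
  rw [e, abs_div, abs_of_pos h2, div_lt_one h2] at h
  linarith

theorem exists_floor_add_gridShift (w : ℝ) (k : ℤ) :
    ∃ b : Bool, ∀ v : ℝ, |v - w| ≤ 1 / 8 → ⌊v + gridShift b k⌋ = ⌊w + gridShift b k⌋ := by
  have key : ∀ s : ℝ, 1 / 8 ≤ Int.fract (w + s) → Int.fract (w + s) < 7 / 8 →
      ∀ v : ℝ, |v - w| ≤ 1 / 8 → ⌊v + s⌋ = ⌊w + s⌋ := by
    intro s h1 h2 v hv
    rw [Int.fract] at h1 h2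
    have := abs_le.1 hv
    rw [Int.floor_eq_iff]
    constructor <;> linarith
  by_cases hw : 1 / 8 ≤ Int.fract w ∧ Int.fract w < 7 / 8
  · exact ⟨false, key _ (by simpa [gridShift] using hw.1) (by simpa [gridShift] using hw.2)⟩
  · refine ⟨true, ?_⟩
    have hs : gridShift true k = 1 / 3 ∨ gridShift true k = 2 / 3 := by
      by_cases hk : Even k <;> simp [gridShift, hk]
    set s := gridShift true k
    have h0 := Int.fract_nonneg w
    have h1 := Int.fract_lt_one w
    have hfl : (⌊w⌋ : ℝ) + Int.fract w = w := Int.floor_add_fract w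
    rcases lt_or_ge (Int.fract w) (1 / 8) with h2 | h2
    · have : Int.fract (w + s) = Int.fract w + s := by
        rw [Int.fract_eq_iff]
        refine ⟨?_, ?_, ⌊w⌋, by linarith⟩ <;> rcases hs with hs | hs <;> linarith
      refine key s ?_ ?_ <;> rw [this] <;> rcases hs with hs | hs <;> linarith
    · have h3 : 7 / 8 ≤ Int.fract w := by
        by_contra h
        exact hw ⟨h2, not_le.1 h⟩
      have : Int.fract (w + s) = Int.fract w + s - 1 := by
        rw [Int.fract_eq_iff]
        refine ⟨?_, ?_, ⌊w⌋ + 1, by push_cast; linarith⟩ <;> rcases hs with hs | hs <;> linarith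
      refine key s ?_ ?_ <;> rw [this] <;> rcases hs with hs | hs <;> linarith

/-- Every cube is contained in a cell of comparable size of one of the shifted grids. -/
theorem exists_gridCell {n : ℕ} (z : Rn n) {r : ℝ} (hr : 0 < r) :
    ∃ (τ : Fin n → Bool) (k : ℤ), cube z r ⊆ gridCell τ k z ∧
      gridCell τ k z ⊆ cube z (16 * r) := by
  obtain ⟨m, hm1, hm2⟩ := exists_mem_Ioc_zpow (x := 4 * r) (y := (2 : ℝ)) (by linarith)
    (by norm_num)
  choose τ hτ using fun i => exists_floor_add_gridShift (z i / 2 ^ (m + 1)) (m + 1)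
  have h2 : (0 : ℝ) < 2 ^ (m + 1) := by positivity
  refine ⟨τ, m + 1, fun x hx i => hτ i _ ?_,
    (gridCell_subset_cube τ _ z).trans (cube_subset_cube z ?_)⟩
  · rw [← sub_div, abs_div, abs_of_pos h2, div_le_iff₀ h2]
    have := hx i
    linarith
  · rw [zpow_add_one₀ (by norm_num)]
    linarith

/-! ### Dilation of cubes in the modular -/

section

variable {n : ℕ} {q : Rn n → ℝ} {Q : ℝ}

theorem exists_stepModular_cube_smul_le_one (hloc : LogHolderLocal q) (hinf : LogHolderInfty q)
    (h1 : ∀ x, 1 ≤ q x) (hQ : ∀ x, q x ≤ Q) (hn : 0 < n) (K : ℝ) :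
    ∃ c : ℝ≥0, 0 < c ∧ ∀ (S : Finset ℕ) (a : ℕ → ℝ≥0) (z : ℕ → Rn n) (r : ℕ → ℝ),
      (∀ j, 0 < r j) → stepModular q S a (fun j => cube (z j) (r j)) ≤ 1 →
      stepModular q S (fun j => c * a j) (fun j => cube (z j) (K * r j)) ≤ 1 := by
  classical
  have hqm : Measurable q := hloc.continuous.measurable
  have hq0 : ∀ x, 0 ≤ q x := fun x => by linarith [h1 x]
  set K' := max K 1 with hK'
  have hK1 : 1 ≤ K' := le_max_right _ _
  obtain ⟨c, hc, H⟩ := exists_stepModular_smul_le_one (ι := ℕ) (M := 16 * K') hloc hinf h1 hQ hn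
    (by linarith)
  set N : ℝ≥0 := (Fintype.card (Fin n → Bool) : ℝ≥0) with hN
  have hN0 : 0 < N := by rw [hN]; exact_mod_cast Fintype.card_pos
  refine ⟨N⁻¹ * c, by positivity, fun S a z r hr hf => ?_⟩
  choose τ k hsub hsup using fun j => exists_gridCell (z j) (mul_pos (zero_lt_one.trans_le hK1)
    (hr j))
  set T : (Fin n → Bool) → Finset ℕ := fun t => S.filter fun j => τ j = t with hT
  set P : ℕ → Set (Rn n) := fun j => gridCell (τ j) (k j) (z j) with hP
  have hmono : ∀ j, cube (z j) (r j) ⊆ cube (z j) (K' * r j) := fun j =>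
    cube_subset_cube _ (le_mul_of_one_le_left (hr j).le hK1)
  have hcover : ∀ t, NestedCover (16 * K') (T t) z r P := fun t =>
    { nested := by
        intro i hi j hj
        have hi' : τ i = t := (Finset.mem_filter.1 hi).2
        have hj' : τ j = t := (Finset.mem_filter.1 hj).2
        simp only [hP, hi', hj']
        rcases le_total (k i) (k j) with hk | hk
        · rcases gridCell_subset_or_disjoint t hk (z i) (z j) with h | h
          · exact Or.inl h
          · exact Or.inr (Or.inr h)
        · rcases gridCell_subset_or_disjoint t hk (z j) (z i) with h | h
          · exact Or.inr (Or.inl h)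
          · exact Or.inr (Or.inr h.symm)
      measurableSet := fun j _ => measurableSet_gridCell _ _ _
      pos := fun j _ => hr j
      cube_subset := fun j _ => (hmono j).trans (hsub j)
      subset_cube := fun j _ => by rw [mul_assoc]; exact hsup j }
  have hPt : ∀ t, stepModular q (T t) (fun j => c * a j) P ≤ 1 := fun t => by
    refine H (T t) a z r P (hcover t) (le_trans (lintegral_mono fun x => ?_) hf)
    rw [ENNReal.coe_le_coe]
    refine NNReal.rpow_le_rpow ?_ (hq0 x)
    exact Finset.sum_le_sum_of_subset (Finset.filter_subset _ _)
  have hpt : ∀ x, stepFun S (fun j => N⁻¹ * c * a j) (fun j => cube (z j) (K * r j)) x ^ q x ≤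
      N⁻¹ * ∑ t, stepFun (T t) (fun j => c * a j) P x ^ q x := by
    intro x
    have e1 : stepFun S (fun j => N⁻¹ * c * a j) (fun j => cube (z j) (K * r j)) x ≤
        ∑ t, N⁻¹ * stepFun (T t) (fun j => c * a j) P x := by
      simp only [mul_assoc]
      rw [stepFun_smul, ← Finset.mul_sum]
      refine mul_le_mul_right ?_ _
      refine (stepFun_mono S _ (Q := P) (fun j _ => (cube_subset_cube _ ?_).trans (hsub j)) x).trans
        (le_of_eq ?_)
      · exact mul_le_mul_of_nonneg_right (le_max_left _ _) (hr j).le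
      · exact (Finset.sum_fiberwise S τ _).symm
    rw [Finset.mul_sum]
    refine (NNReal.rpow_le_rpow e1 (hq0 x)).trans ?_
    refine NNReal.rpow_arith_mean_le_arith_mean_rpow Finset.univ (fun _ => N⁻¹) _ ?_ (h1 x)
    simp [hN]
  calc stepModular q S (fun j => N⁻¹ * c * a j) (fun j => cube (z j) (K * r j))
      ≤ ∫⁻ x, (N⁻¹ : ℝ≥0) * ∑ t,
          ((stepFun (T t) (fun j => c * a j) P x ^ q x : ℝ≥0) : ℝ≥0∞) := by
        refine lintegral_mono fun x => (ENNReal.coe_le_coe.2 (hpt x)).trans_eq ?_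
        rw [ENNReal.coe_mul, ENNReal.ofNNReal_finsetSum]
    _ = (N⁻¹ : ℝ≥0) * ∑ t, stepModular q (T t) (fun j => c * a j) P := by
        rw [lintegral_const_mul' _ _ ENNReal.coe_ne_top, lintegral_finsetSum]
        · rfl
        · exact fun t _ => ((measurable_stepFun _ _ (hcover t).measurableSet).pow
            hqm).coe_nnreal_ennreal
    _ ≤ (N⁻¹ : ℝ≥0) * ∑ _t : Fin n → Bool, 1 := by
        gcongr with t
        exact hPt t
    _ = 1 := by
        rw [Finset.sum_const, Finset.card_univ, nsmul_one,
          ← ENNReal.coe_natCast, ← ENNReal.coe_mul, inv_mul_cancel₀ hN0.ne', ENNReal.coe_one]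

theorem measurable_cubeInd (z : Rn n) (r : ℝ) : Measurable (cubeInd z r) :=
  measurable_one.indicator (measurableSet_cube z r)

theorem ne_top_of_lintegral_rpow_le_one (h1 : ∀ x, 1 ≤ q x) {a : ℕ → ℝ≥0∞} {z : ℕ → Rn n}
    {r : ℕ → ℝ} (hr : ∀ j, 0 < r j)
    (h : ∫⁻ x, (∑' j, a j * cubeInd (z j) (r j) x) ^ q x ≤ 1) (j : ℕ) : a j ≠ ∞ := by
  intro hj
  have : ∫⁻ _ in cube (z j) (r j), ∞ ≤ 1 := by
    refine le_trans (le_trans (setLIntegral_mono' (measurableSet_cube _ _) fun x hx => ?_)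
      (setLIntegral_le_lintegral _ _)) h
    have e : (∑' j, a j * cubeInd (z j) (r j) x) = ∞ := by
      refine top_le_iff.1 (le_trans ?_ (ENNReal.le_tsum j))
      simp [hj, cubeInd, hx]
    rw [e, ENNReal.top_rpow_of_pos (by linarith [h1 x])]
  rw [setLIntegral_const, volume_cube, ENNReal.top_mul] at this
  · simp at this
  · simp [hr j]

/-- Dilating the cubes changes the modular in a controlled way. -/
theorem exists_lintegral_tsum_dilate_le_one (hloc : LogHolderLocal q) (hinf : LogHolderInfty q)
    (h1 : ∀ x, 1 ≤ q x) (hQ : ∀ x, q x ≤ Q) (hn : 0 < n) (K : ℝ) :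
    ∃ c : ℝ≥0, 0 < c ∧ ∀ (a : ℕ → ℝ≥0∞) (z : ℕ → Rn n) (r : ℕ → ℝ), (∀ j, 0 < r j) →
      ∫⁻ x, (∑' j, a j * cubeInd (z j) (r j) x) ^ q x ≤ 1 →
      ∫⁻ x, (c * ∑' j, a j * cubeInd (z j) (K * r j) x) ^ q x ≤ 1 := by
  have hqm : Measurable q := hloc.continuous.measurable
  have hq0 : ∀ x, 0 ≤ q x := fun x => by linarith [h1 x]
  obtain ⟨c, hc, H⟩ := exists_stepModular_cube_smul_le_one hloc hinf h1 hQ hn K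
  refine ⟨c, hc, fun a z r hr hf => ?_⟩
  lift a to ℕ → ℝ≥0 using ne_top_of_lintegral_rpow_le_one h1 hr hf
  have coe : ∀ (N : ℕ) (r : ℕ → ℝ) (x : Rn n),
      (stepFun (Finset.range N) a (fun j => cube (z j) (r j)) x : ℝ≥0∞) =
        ∑ j ∈ Finset.range N, (a j : ℝ≥0∞) * cubeInd (z j) (r j) x := by
    intro N r x
    rw [stepFun, ENNReal.ofNNReal_finsetSum]
    refine Finset.sum_congr rfl fun j _ => ?_
    by_cases hx : x ∈ cube (z j) (r j) <;> simp [cubeInd, hx]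
  have hmod : ∀ N : ℕ, ∫⁻ x, (c * ∑ j ∈ Finset.range N,
      (a j : ℝ≥0∞) * cubeInd (z j) (K * r j) x) ^ q x ≤ 1 := by
    intro N
    have hfN : stepModular q (Finset.range N) a (fun j => cube (z j) (r j)) ≤ 1 := by
      refine le_trans (lintegral_mono fun x => ?_) hf
      rw [ENNReal.coe_rpow_of_nonneg _ (hq0 x), coe]
      exact ENNReal.rpow_le_rpow (ENNReal.sum_le_tsum _) (hq0 x)
    refine le_trans (le_of_eq (lintegral_congr fun x => ?_)) (H (Finset.range N) a z r hr hfN)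
    rw [← coe N (fun j => K * r j), stepFun_smul, ← ENNReal.coe_mul,
      ENNReal.coe_rpow_of_nonneg _ (hq0 x)]
  have hlim : ∀ x, Filter.Tendsto (fun N : ℕ => (c * ∑ j ∈ Finset.range N,
      (a j : ℝ≥0∞) * cubeInd (z j) (K * r j) x) ^ q x) Filter.atTop
      (nhds ((c * ∑' j, (a j : ℝ≥0∞) * cubeInd (z j) (K * r j) x) ^ q x)) := fun x =>
    (ENNReal.continuous_rpow_const.tendsto _).comp
      (ENNReal.Tendsto.const_mul (ENNReal.tendsto_nat_tsum _) (Or.inr ENNReal.coe_ne_top))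
  calc _ = ∫⁻ x, Filter.liminf (fun N : ℕ => (c * ∑ j ∈ Finset.range N,
        (a j : ℝ≥0∞) * cubeInd (z j) (K * r j) x) ^ q x) Filter.atTop :=
        lintegral_congr fun x => (hlim x).liminf_eq.symm
    _ ≤ Filter.liminf (fun N : ℕ => ∫⁻ x, (c * ∑ j ∈ Finset.range N,
        (a j : ℝ≥0∞) * cubeInd (z j) (K * r j) x) ^ q x) Filter.atTop := by
        refine lintegral_liminf_le fun N => Measurable.pow ?_ hqm
        exact (Finset.measurable_sum _ fun j _ => (measurable_cubeInd _ _).const_mul _).const_mul _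
    _ ≤ 1 := by
        refine (Filter.liminf_le_liminf (Filter.Eventually.of_forall hmod)).trans ?_
        simp

end

/-! ### The variable Lebesgue quasinorm -/

section

variable {n : ℕ} {p : Rn n → ℝ}

theorem varLpNorm_le_mul {f g : Rn n → ℝ≥0∞} {C : ℝ≥0} (hC : 0 < C)
    (h : ∀ l : ℝ≥0, 0 < l → ∫⁻ x, (g x / l) ^ p x ≤ 1 →
      ∫⁻ x, (f x / (C * l : ℝ≥0)) ^ p x ≤ 1) :
    varLpNorm p f ≤ C * varLpNorm p g := by
  have hC0 : (C : ℝ≥0∞) ≠ 0 := by simpa using hC.ne'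
  rw [← ENNReal.inv_mul_le_iff hC0 ENNReal.coe_ne_top]
  refine le_iInf fun l => le_iInf fun hl => le_iInf fun hg => ?_
  rw [ENNReal.inv_mul_le_iff hC0 ENNReal.coe_ne_top, ← ENNReal.coe_mul]
  exact iInf_le_of_le (C * l) (iInf_le_of_le (mul_pos hC hl) (iInf_le_of_le (h l hl hg) le_rfl))

theorem varLpNorm_mono (hp : ∀ x, 0 < p x) {f g : Rn n → ℝ≥0∞} (h : ∀ x, f x ≤ g x) :
    varLpNorm p f ≤ varLpNorm p g := by
  have := varLpNorm_le_mul (p := p) (f := f) (g := g) one_pos fun l _ hg =>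
    le_trans (lintegral_mono fun x => ENNReal.rpow_le_rpow
      (by rw [one_mul]; exact ENNReal.div_le_div_right (h x) _) (hp x).le) hg
  simpa using this

theorem varLpNorm_const_mul_le (f : Rn n → ℝ≥0∞) {C : ℝ≥0} (hC : 0 < C) :
    varLpNorm p (fun x => C * f x) ≤ C * varLpNorm p f := by
  refine varLpNorm_le_mul hC fun l _ hf => ?_
  refine le_trans (le_of_eq (lintegral_congr fun x => ?_)) hf
  rw [ENNReal.coe_mul, ENNReal.mul_div_mul_left _ _ (by simpa using hC.ne') ENNReal.coe_ne_top]

theorem rpow_one_div_div_rpow {u : ℝ} (hu : 0 < u) (s : ℝ) (t : ℝ≥0∞) {l : ℝ≥0} :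
    (t ^ (1 / u) / l) ^ s = (t / (l ^ u : ℝ≥0)) ^ (s / u) := by
  have : t ^ (1 / u) / l = (t / (l ^ u : ℝ≥0)) ^ (1 / u) := by
    rw [ENNReal.div_rpow_of_nonneg _ _ (by positivity), ENNReal.coe_rpow_of_nonneg _ hu.le,
      ← ENNReal.rpow_mul, mul_one_div_cancel hu.ne', ENNReal.rpow_one]
  rw [this, ← ENNReal.rpow_mul]
  congr 1
  ring

theorem LogHolderLocal.div_const (h : LogHolderLocal p) {u : ℝ} (hu : 0 < u) :
    LogHolderLocal fun x => p x / u := by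
  obtain ⟨c, hc, h⟩ := h
  refine ⟨c / u, by positivity, fun x y hxy => ?_⟩
  rw [← sub_div, abs_div, abs_of_pos hu, div_right_comm]
  gcongr
  exact h x y hxy

theorem LogHolderInfty.div_const (h : LogHolderInfty p) {u : ℝ} (hu : 0 < u) :
    LogHolderInfty fun x => p x / u := by
  obtain ⟨C, hC, pinf, h⟩ := h
  refine ⟨C / u, by positivity, pinf / u, fun x => ?_⟩
  rw [← sub_div, abs_div, abs_of_pos hu, div_right_comm]
  gcongr
  exact h x

theorem pLow_le (hp : ∀ x, 0 < p x) (x : Rn n) : pLow p ≤ p x :=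
  ciInf_le ⟨0, by rintro _ ⟨x, rfl⟩; exact (hp x).le⟩ x

theorem exists_varLpNorm_tsum_dilate_le (hn : 0 < n) (hp : ∀ x, 0 < p x)
    (hploc : LogHolderLocal p) (hpinf : LogHolderInfty p) (hpm : 0 < pLow p)
    (hpp : BddAbove (Set.range p)) (K : ℝ) :
    ∃ C : ℝ≥0, 0 < C ∧ ∀ (a : ℕ → ℝ≥0∞) (z : ℕ → Rn n) (r : ℕ → ℝ), (∀ j, 0 < r j) →
      varLpNorm p (fun x => (∑' j, a j * cubeInd (z j) (K * r j) x) ^ (1 / pUnder p)) ≤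
        C * varLpNorm p (fun x => (∑' j, a j * cubeInd (z j) (r j) x) ^ (1 / pUnder p)) := by
  set u := pUnder p with hu
  have hu0 : 0 < u := lt_min hpm one_pos
  obtain ⟨Q, hQ⟩ := hpp
  obtain ⟨c, hc, H⟩ := exists_lintegral_tsum_dilate_le_one (q := fun x => p x / u) (Q := Q / u)
    (hploc.div_const hu0) (hpinf.div_const hu0)
    (fun x => by rw [one_le_div hu0]; exact (min_le_left _ _).trans (pLow_le hp x))
    (fun x => by gcongr; exact hQ ⟨x, rfl⟩) hn K
  have hcu : 0 < c⁻¹ ^ (1 / u) := NNReal.rpow_pos (by positivity)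
  refine ⟨c⁻¹ ^ (1 / u), hcu, fun a z r hr => varLpNorm_le_mul hcu fun l hl hf => ?_⟩
  have hlu : (0 : ℝ≥0) < l ^ u := NNReal.rpow_pos hl
  have scale : ∀ (s : ℕ → ℝ) (x : Rn n),
      ∑' j, a j / (l ^ u : ℝ≥0) * cubeInd (z j) (s j) x =
        (∑' j, a j * cubeInd (z j) (s j) x) / (l ^ u : ℝ≥0) := by
    intro s x
    rw [div_eq_mul_inv, ← ENNReal.tsum_mul_right]
    refine tsum_congr fun j => ?_
    rw [div_eq_mul_inv]; ring
  have h2 := H (fun j => a j / (l ^ u : ℝ≥0)) z r hr (by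
    refine le_trans (le_of_eq (lintegral_congr fun x => ?_)) hf
    rw [scale r, rpow_one_div_div_rpow hu0])
  refine le_trans (le_of_eq (lintegral_congr fun x => ?_)) h2
  rw [scale (fun j => K * r j), rpow_one_div_div_rpow hu0, NNReal.mul_rpow, ← NNReal.rpow_mul,
    one_div_mul_cancel hu0.ne', NNReal.rpow_one]
  congr 1
  rw [ENNReal.coe_mul, ENNReal.coe_inv hc.ne', div_eq_mul_inv, div_eq_mul_inv,
    ENNReal.mul_inv (by simp) (by simp [hc.ne']), inv_inv]
  ring

theorem exists_lintegral_comp_eq (T : Rn n ≃L[ℝ] Rn n) :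
    ∃ d : ℝ≥0, ∀ g : Rn n → ℝ≥0∞, ∫⁻ x, g (T x) = d * ∫⁻ x, g x := by
  refine ⟨Real.toNNReal |(LinearMap.det (T : Rn n →ₗ[ℝ] Rn n))⁻¹|, fun g => ?_⟩
  have h := Measure.map_linearMap_addHaar_eq_smul_addHaar (volume : Measure (Rn n))
    (f := (T : Rn n →ₗ[ℝ] Rn n)) (LinearEquiv.isUnit_det' T.toLinearEquiv).ne_zero
  have h2 := lintegral_map_equiv (μ := volume) g T.toHomeomorph.toMeasurableEquiv
  calc ∫⁻ x, g (T x) = ∫⁻ x, g x ∂(Measure.map T volume) := h2.symm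
    _ = _ := by
      have h' : Measure.map T (volume : Measure (Rn n)) =
          ENNReal.ofReal |(LinearMap.det (T : Rn n →ₗ[ℝ] Rn n))⁻¹| • volume := h
      rw [h', lintegral_smul_measure]
      rfl

theorem exists_varLpNorm_comp_le (hp : ∀ x, 0 < p x) (hpm : 0 < pLow p) (T : Rn n ≃L[ℝ] Rn n)
    (hT : ∀ x, p (T x) = p x) :
    ∃ C : ℝ≥0, 0 < C ∧ ∀ g : Rn n → ℝ≥0∞,
      varLpNorm p (fun x => g (T x)) ≤ C * varLpNorm p g := by
  obtain ⟨d, hd⟩ := exists_lintegral_comp_eq T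
  set m := pLow p with hm
  set B : ℝ≥0 := max 1 d with hB
  have hB1 : 1 ≤ B := le_max_left _ _
  set C : ℝ≥0 := B ^ (1 / m) with hCdef
  have hC1 : 1 ≤ C := NNReal.one_le_rpow hB1 (by positivity)
  have hC0 : 0 < C := one_pos.trans_le hC1
  have hCm : C ^ m = B := by
    rw [hCdef, ← NNReal.rpow_mul, one_div_mul_cancel hpm.ne', NNReal.rpow_one]
  refine ⟨C, hC0, fun g => varLpNorm_le_mul hC0 fun l hl hg => ?_⟩
  have key : ∀ x, (g x / (C * l : ℝ≥0)) ^ p x ≤ (B⁻¹ : ℝ≥0) * (g x / l) ^ p x := by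
    intro x
    have e : g x / (C * l : ℝ≥0) = (C⁻¹ : ℝ≥0) * (g x / l) := by
      rw [ENNReal.coe_mul, ENNReal.coe_inv hC0.ne', div_eq_mul_inv, div_eq_mul_inv,
        ENNReal.mul_inv (by simp) (by simp)]
      ring
    rw [e, ENNReal.mul_rpow_of_nonneg _ _ (hp x).le, ← ENNReal.coe_rpow_of_nonneg _ (hp x).le]
    gcongr
    rw [NNReal.inv_rpow, ← hCm]
    gcongr
    exact pLow_le hp x
  calc ∫⁻ x, (g (T x) / (C * l : ℝ≥0)) ^ p x
      = ∫⁻ x, (fun y => (g y / (C * l : ℝ≥0)) ^ p y) (T x) := by simp only [hT]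
    _ = d * ∫⁻ x, (g x / (C * l : ℝ≥0)) ^ p x :=
        hd fun y => (g y / (C * l : ℝ≥0)) ^ p y
    _ ≤ B * ((B⁻¹ : ℝ≥0) * 1) := by
        gcongr
        · exact le_max_right _ _
        · refine (lintegral_mono key).trans ?_
          rw [lintegral_const_mul' _ _ ENNReal.coe_ne_top]
          gcongr
    _ = 1 := by
        rw [mul_one, ← ENNReal.coe_mul, mul_inv_cancel₀ (one_pos.trans_le hB1).ne',
          ENNReal.coe_one]

theorem map_mem_cube (L : Rn n →L[ℝ] Rn n) {x z : Rn n} {s : ℝ} (hx : x ∈ cube z s) :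
    L x ∈ cube (L z) (‖L‖ * n * s) := by
  intro i
  have h1 : ‖x - z‖ ≤ n * (s / 2) := norm_le_of_forall_abs_le hx
  calc |L x i - L z i| = ‖(L (x - z)) i‖ := by rw [map_sub]; rfl
    _ ≤ ‖L (x - z)‖ := PiLp.norm_apply_le _ i
    _ ≤ ‖L‖ * ‖x - z‖ := L.le_opNorm _
    _ ≤ ‖L‖ * (n * (s / 2)) := by gcongr
    _ = ‖L‖ * n * s / 2 := by ring

theorem AFun_eq (hpm : 0 < pLow p) (lam : ℕ → ℝ≥0) (z : ℕ → Rn n) (r : ℕ → ℝ) :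
    AFun p lam z r = varLpNorm p (fun x =>
      (∑' j, (lam j / varLpNorm p (cubeInd (z j) (r j))) ^ pUnder p * cubeInd (z j) (r j) x) ^
        (1 / pUnder p)) := by
  have hu0 : 0 < pUnder p := lt_min hpm one_pos
  unfold AFun
  congr 1
  funext x
  congr 1
  refine tsum_congr fun j => ?_
  by_cases hx : x ∈ cube (z j) (r j) <;> simp [cubeInd, hx, hu0]

theorem exists_varLpNorm_cubeInd_le (hn : 0 < n) (hp : ∀ x, 0 < p x)
    (hploc : LogHolderLocal p) (hpinf : LogHolderInfty p) (hpm : 0 < pLow p)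
    (hpp : BddAbove (Set.range p)) (K : ℝ) :
    ∃ C : ℝ≥0, 0 < C ∧ ∀ (z : Rn n) (r : ℝ), 0 < r →
      varLpNorm p (cubeInd z (K * r)) ≤ C * varLpNorm p (cubeInd z r) := by
  have hu0 : 0 < pUnder p := lt_min hpm one_pos
  obtain ⟨C, hC, H⟩ := exists_varLpNorm_tsum_dilate_le hn hp hploc hpinf hpm hpp K
  refine ⟨C, hC, fun z r hr => ?_⟩
  have e : ∀ s : ℝ, (fun x => (∑' j : ℕ, (if j = 0 then 1 else 0) * cubeInd z s x) ^
      (1 / pUnder p)) = cubeInd z s := by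
    intro s
    funext x
    rw [tsum_eq_single 0 (fun j hj => by simp [hj])]
    by_cases hx : x ∈ cube z s <;> simp [cubeInd, hx, hu0]
  have := H (fun j => if j = 0 then 1 else 0) (fun _ => z) (fun _ => r) fun _ => hr
  rwa [e, e] at this

end

theorem exists_AFun_map_dilate_le {n : ℕ} (hn : 0 < n) {p : Rn n → ℝ} (hp : ∀ x, 0 < p x)
    (hploc : LogHolderLocal p) (hpinf : LogHolderInfty p) (hpm : 0 < pLow p)
    (hpp : BddAbove (Set.range p)) (T : Rn n ≃L[ℝ] Rn n) (hT : ∀ x, p (T x) = p x)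
    {κ : ℝ} (hκ : 0 < κ) :
    ∃ C : ℝ≥0, 0 < C ∧ ∀ (lam : ℕ → ℝ≥0) (z : ℕ → Rn n) (r : ℕ → ℝ), (∀ j, 0 < r j) →
      AFun p lam (fun j => T (z j)) (fun j => κ * r j) ≤ C * AFun p lam z r := by
  have hu0 : 0 < pUnder p := lt_min hpm one_pos
  have hT' : ∀ x, p (T.symm x) = p x := fun x => by rw [← hT, T.apply_symm_apply]
  set L : Rn n →L[ℝ] Rn n := (T : Rn n →L[ℝ] Rn n) with hL
  set L' : Rn n →L[ℝ] Rn n := (T.symm : Rn n →L[ℝ] Rn n) with hL'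
  set δ : ℝ := (‖L'‖ * n + 1)⁻¹ with hδ
  have hδ0 : 0 < δ := by positivity
  obtain ⟨C₁, hC₁, H₁⟩ := exists_varLpNorm_comp_le hp hpm T hT
  obtain ⟨C₂, hC₂, H₂⟩ := exists_varLpNorm_comp_le hp hpm T.symm hT'
  obtain ⟨C₃, hC₃, H₃⟩ := exists_varLpNorm_cubeInd_le hn hp hploc hpinf hpm hpp (‖L‖ * n / κ)
  obtain ⟨C₄, hC₄, H₄⟩ := exists_varLpNorm_tsum_dilate_le hn hp hploc hpinf hpm hpp (κ / δ)
  have hind : ∀ (z : Rn n) (r : ℝ), 0 < r → varLpNorm p (cubeInd z r) ≤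
      (C₁ * C₃ : ℝ≥0) * varLpNorm p (cubeInd (T z) (κ * r)) := by
    intro z r hr
    calc varLpNorm p (cubeInd z r)
        ≤ varLpNorm p (fun x => cubeInd (T z) (‖L‖ * n / κ * (κ * r)) (T x)) := by
          refine varLpNorm_mono hp fun x => ?_
          by_cases hx : x ∈ cube z r
          · have h1 : T x ∈ cube (T z) (‖L‖ * n / κ * (κ * r)) := by
              have e : ‖L‖ * n / κ * (κ * r) = ‖L‖ * n * r := by field_simp
              rw [e]
              exact map_mem_cube L hx
            simp [cubeInd, hx, h1]
          · simp [cubeInd, hx]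
      _ ≤ C₁ * (C₃ * varLpNorm p (cubeInd (T z) (κ * r))) :=
          (H₁ _).trans (mul_le_mul_right (H₃ _ _ (by positivity)) _)
      _ = _ := by rw [ENNReal.coe_mul, mul_assoc]
  set B : ℝ≥0 := C₁ * C₃ with hB
  have hB0 : 0 < B := by positivity
  refine ⟨B * (C₄ * C₂), by positivity, fun lam z r hr => ?_⟩
  rw [AFun_eq hpm, AFun_eq hpm]
  set α : ℕ → ℝ≥0∞ := fun j => (lam j / varLpNorm p (cubeInd (z j) (r j))) ^ pUnder p with hα
  have hcoef : ∀ j, ((lam j : ℝ≥0∞) / varLpNorm p (cubeInd (T (z j)) (κ * r j))) ^ pUnder p ≤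
      (B : ℝ≥0∞) ^ pUnder p * α j := by
    intro j
    rw [hα, ← ENNReal.mul_rpow_of_nonneg _ _ hu0.le]
    refine ENNReal.rpow_le_rpow ?_ hu0.le
    have hB' : (B : ℝ≥0∞) ≠ 0 := by simpa using hB0.ne'
    rw [← ENNReal.mul_div_mul_left _ _ hB' ENNReal.coe_ne_top, ← mul_div_assoc]
    exact ENNReal.div_le_div_left (hind (z j) (r j) (hr j)) _
  calc _ ≤ varLpNorm p (fun x => B * (∑' j, α j * cubeInd (T (z j)) (κ * r j) x) ^
        (1 / pUnder p)) := by
        refine varLpNorm_mono hp fun x => ?_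
        have e : (B : ℝ≥0∞) * (∑' j, α j * cubeInd (T (z j)) (κ * r j) x) ^ (1 / pUnder p) =
            ((B : ℝ≥0∞) ^ pUnder p * ∑' j, α j * cubeInd (T (z j)) (κ * r j) x) ^
              (1 / pUnder p) := by
          rw [ENNReal.mul_rpow_of_nonneg _ _ (by positivity), ← ENNReal.rpow_mul,
            mul_one_div_cancel hu0.ne', ENNReal.rpow_one]
        rw [e, ← ENNReal.tsum_mul_left]
        refine ENNReal.rpow_le_rpow (ENNReal.tsum_le_tsum fun j => ?_) (by positivity)
        rw [← mul_assoc]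
        exact mul_le_mul_left (hcoef j) _
    _ ≤ B * varLpNorm p (fun x => (∑' j, α j * cubeInd (T (z j)) (κ * r j) x) ^
        (1 / pUnder p)) := varLpNorm_const_mul_le _ hB0
    _ ≤ B * (C₄ * varLpNorm p (fun x => (∑' j, α j * cubeInd (T (z j)) (δ * r j) x) ^
        (1 / pUnder p))) := by
        gcongr
        have := H₄ α (fun j => T (z j)) (fun j => δ * r j) fun j => mul_pos hδ0 (hr j)
        have e : ∀ j, κ / δ * (δ * r j) = κ * r j := fun j => by field_simp
        simpa only [e] using this
    _ ≤ B * (C₄ * (C₂ * varLpNorm p (fun x => (∑' j, α j *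
        cubeInd (T (z j)) (δ * r j) (T x)) ^ (1 / pUnder p)))) := by
        gcongr
        have := H₂ fun x => (∑' j, α j * cubeInd (T (z j)) (δ * r j) (T x)) ^ (1 / pUnder p)
        simpa only [T.apply_symm_apply] using this
    _ ≤ B * (C₄ * (C₂ * varLpNorm p (fun x => (∑' j, α j * cubeInd (z j) (r j) x) ^
        (1 / pUnder p)))) := by
        gcongr
        refine varLpNorm_mono hp fun x => ?_
        refine ENNReal.rpow_le_rpow (ENNReal.tsum_le_tsum fun j => ?_) (by positivity)
        refine mul_le_mul_right ?_ _
        by_cases hx : T x ∈ cube (T (z j)) (δ * r j)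
        · have h1 : x ∈ cube (z j) (r j) := by
            have h2 := map_mem_cube L' hx
            simp only [hL', ContinuousLinearEquiv.coe_coe, T.symm_apply_apply] at h2
            refine cube_subset_cube _ ?_ h2
            rw [← mul_assoc]
            refine mul_le_of_le_one_left (hr j).le ?_
            rw [hδ, ← div_eq_mul_inv, div_le_one (by positivity)]
            linarith
          simp [cubeInd, hx, h1]
        · simp [cubeInd, hx]
    _ = _ := by
        simp only [hα, ENNReal.coe_mul, mul_assoc]

theorem A_functional_matrix_dilated_cubes
    {n : ℕ} (hn : 0 < n)
    (A : Matrix (Fin n) (Fin n) ℝ) (hA : IsUnit A)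
    (p : Rn n → ℝ) (hp : ∀ x, 0 < p x)
    (hploc : LogHolderLocal p) (hpinf : LogHolderInfty p)
    (hpm : 0 < pLow p) (hpp : BddAbove (Set.range p))
    (hpA : ∀ x : Rn n, p (Matrix.toEuclideanCLM (𝕜 := ℝ) A x) = p x) :
    ∃ C : ℝ≥0, 0 < C ∧ ∀ (lam : ℕ → ℝ≥0) (z : ℕ → Rn n) (r : ℕ → ℝ), (∀ j, 0 < r j) →
      AFun p lam (fun j => Matrix.toEuclideanCLM (𝕜 := ℝ) A (z j))
          (fun j => 4 * ‖Matrix.toEuclideanCLM (𝕜 := ℝ) A‖ * r j) ≤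
        C * AFun p lam z r := by
  have : Nonempty (Fin n) := ⟨⟨0, hn⟩⟩
  have hU : IsUnit (Matrix.toEuclideanCLM (𝕜 := ℝ) A) :=
    hA.map (Matrix.toEuclideanCLM (n := Fin n) (𝕜 := ℝ))
  obtain ⟨U, hU'⟩ := hU
  have hT : ∀ x, ContinuousLinearEquiv.ofUnit U x = Matrix.toEuclideanCLM (𝕜 := ℝ) A x := by
    intro x; rw [← hU']; rfl
  have hD : 0 < ‖Matrix.toEuclideanCLM (𝕜 := ℝ) A‖ := by
    rw [norm_pos_iff, ← hU']
    exact U.ne_zero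
  obtain ⟨C, hC, H⟩ := exists_AFun_map_dilate_le hn hp hploc hpinf hpm hpp
    (ContinuousLinearEquiv.ofUnit U) (fun x => by rw [hT, hpA])
    (κ := 4 * ‖Matrix.toEuclideanCLM (𝕜 := ℝ) A‖) (by positivity)
  refine ⟨C, hC, fun lam z r hr => ?_⟩
  have := H lam z r hr
  simpa only [hT] using this
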